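/- arXiv:0710.5582 — 2 statements merged into one kernel-verified Lean document; each statement's English description precedes it below -/
import Mathlib

section
/- Let n ≥ 2 and s ≥ 2 be integers and let λ > 0. Let Π denote the set of functions x : [s] → ℕ with Σ_{i=1}^s x(i) = n−1. Suppose that for each player p ∈ [n] and each strategy i ∈ [s] we are given a utility function u_p,i : Π → [0,1] that is λ-Lipschitz with respect to the L¹ distance, i.e. |u_p,i(x) − u_p,i(y)| ≤ λ · Σ_{j=1}^s |x(j) − y(j)| for all x, y ∈ Π. Then there exists a pure strategy profile S : [n] → [s] such that for every player p ∈ [n] and every strategy i ∈ [s], u_p,S(p)(x[S,p]) + (8s² + 12s + 4)·λ ≥ u_p,i(x[S,p]), where x[S,p] ∈ Π is defined by x[S,p](j) = |{q ∈ [n] : q ≠ p and S(q) = j}|. In other words, every anonymous game with s strategies and Lipschitz constant λ has an ε-approximate pure Nash equilibrium with ε = (8s² + 12s + 4)λ = O(s²)λ. -/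
open Finset

namespace ScarfAux

set_option linter.unusedSectionVars false

variable {T I : Type*} [Fintype T] [DecidableEq T] [Fintype I] [DecidableEq I]

/-- Dominance. -/
def Dom (r : I → T → ℕ) (σ : Finset T) (C : Finset I) : Prop :=
  ∀ y, ∃ i ∈ C, ∀ x ∈ σ, r i y ≤ r i x

/-- The door `d` belongs to the room `e`. -/
def Inc (d e : Finset T × Finset I) : Prop :=
  (d.2 = e.2 ∧ ∃ x, x ∉ d.1 ∧ e.1 = insert x d.1) ∨
  (e.1 = d.1 ∧ ∃ k, k ∉ e.2 ∧ d.2 = insert k e.2)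

/-- Rooms of a door attached to the index `k`. -/
def Typ (r : I → T → ℕ) (m : I → T) (τ : Finset T) (D : Finset I) (k : I)
    (e : Finset T × Finset I) : Prop :=
  (e.1 = τ ∧ e.2 = D.erase k) ∨
  (e.2 = D ∧ ∃ y, y ∉ τ ∧ e.1 = insert y τ ∧ ∀ l ∈ D.erase k, r l (m l) < r l y)

lemma Dom.mono {r : I → T → ℕ} {σ τ : Finset T} {C D : Finset I} (h : Dom r σ C)
    (h1 : τ ⊆ σ) (h2 : C ⊆ D) : Dom r τ D := by
  intro y
  obtain ⟨i, hi, hx⟩ := h y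
  exact ⟨i, h2 hi, fun x hx' => hx x (h1 hx')⟩

lemma typ_exists (r : I → T → ℕ) (m : I → T) (τ : Finset T) (D : Finset I)
    (hmm : ∀ i, m i ∈ τ) (hm : ∀ i, ∀ x ∈ τ, r i (m i) ≤ r i x)
    (hD : Dom r τ D) (hcard : D.card = τ.card + 1) (k : I) (hk : k ∈ D)
    (hsurj : ∀ x ∈ τ, ∃ l ∈ D.erase k, m l = x) :
    ∃ e : Finset T × Finset I, Typ r m τ D k e ∧ Dom r e.1 e.2 ∧ e.1.card = e.2.card := by
  by_cases h : Dom r τ (D.erase k)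
  · refine ⟨(τ, D.erase k), Or.inl ⟨rfl, rfl⟩, h, ?_⟩
    simp [Finset.card_erase_of_mem hk, hcard]
  · have hne : (univ.filter (fun y => ∀ l ∈ D.erase k, r l (m l) < r l y)).Nonempty := by
      unfold Dom at h
      push Not at h
      obtain ⟨y, hy⟩ := h
      refine ⟨y, ?_⟩
      simp only [mem_filter, mem_univ, true_and]
      intro l hl
      obtain ⟨x, hx, hlt⟩ := hy l hl
      exact lt_of_le_of_lt (hm l x hx) hlt
    obtain ⟨y, hy, hmax⟩ := Finset.exists_max_image _ (r k) hne
    simp only [mem_filter, mem_univ, true_and] at hy hmax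
    have hyk : ∀ z, (∀ l ∈ D.erase k, r l (m l) < r l z) → ∀ x ∈ τ, r k z ≤ r k x := by
      intro z hz
      obtain ⟨i, hi, hx⟩ := hD z
      by_cases hik : i = k
      · subst hik; exact hx
      · have := hz i (mem_erase.2 ⟨hik, hi⟩)
        have := hx _ (hmm i)
        omega
    have hyτ : y ∉ τ := by
      intro hyτ
      obtain ⟨l, hl, he⟩ := hsurj y hyτ
      have := hy l hl
      rw [he] at this
      exact lt_irrefl _ this
    refine ⟨(insert y τ, D), Or.inr ⟨rfl, y, hyτ, rfl, hy⟩, ?_, ?_⟩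
    · intro z
      by_cases hz : ∀ l ∈ D.erase k, r l (m l) < r l z
      · refine ⟨k, hk, ?_⟩
        intro x hx
        rcases mem_insert.1 hx with rfl | hx
        · exact hmax z hz
        · exact hyk z hz x hx
      · push Not at hz
        obtain ⟨l, hl, hle⟩ := hz
        refine ⟨l, (mem_erase.1 hl).2, ?_⟩
        intro x hx
        rcases mem_insert.1 hx with rfl | hx
        · exact hle.trans (hy l hl).le
        · exact hle.trans (hm l x hx)
    · simp [card_insert_of_notMem hyτ, hcard]


lemma typ_unique (r : I → T → ℕ) (hr : ∀ i, Function.Injective (r i))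
    (m : I → T) (τ : Finset T) (D : Finset I)
    (hmm : ∀ i, m i ∈ τ) (k : I) (hk : k ∈ D)
    (e e' : Finset T × Finset I) (h : Typ r m τ D k e) (h' : Typ r m τ D k e')
    (hd : Dom r e.1 e.2) (hd' : Dom r e'.1 e'.2) : e = e' := by
  obtain ⟨σ, C⟩ := e
  obtain ⟨σ', C'⟩ := e'
  simp only [Typ] at h h' hd hd'
  have key : ∀ y y', (∀ l ∈ D.erase k, r l (m l) < r l y') →
      Dom r (insert y τ) D → r k y' ≤ r k y := by
    intro y y' hy' hdom
    obtain ⟨l, hl, hx⟩ := hdom y'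
    by_cases hlk : l = k
    · subst hlk; exact hx y (mem_insert_self _ _)
    · have h1 := hy' l (mem_erase.2 ⟨hlk, hl⟩)
      have h2 := hx (m l) (mem_insert_of_mem (hmm l))
      omega
  have key2 : ∀ y, (∀ l ∈ D.erase k, r l (m l) < r l y) → ¬ Dom r τ (D.erase k) := by
    intro y hy hdom
    obtain ⟨l, hl, hx⟩ := hdom y
    have h1 := hy l hl
    have h2 := hx (m l) (hmm l)
    omega
  rcases h with ⟨rfl, rfl⟩ | ⟨rfl, y, hy, rfl, hlt⟩
  · rcases h' with ⟨rfl, rfl⟩ | ⟨rfl, y', hy', rfl, hlt'⟩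
    · rfl
    · exact absurd hd (key2 y' hlt')
  · rcases h' with ⟨rfl, rfl⟩ | ⟨rfl, y', hy', rfl, hlt'⟩
    · exact absurd hd' (key2 y hlt)
    · have : y = y' := hr k (le_antisymm (key y' y hlt hd') (key y y' hlt' hd))
      rw [this]

lemma door_two (r : I → T → ℕ) (hr : ∀ i, Function.Injective (r i))
    (τ : Finset T) (D : Finset I) (hne : τ.Nonempty)
    (hD : Dom r τ D) (hcard : D.card = τ.card + 1) :
    ∃ a b : Finset T × Finset I, a ≠ b ∧ ∀ e : Finset T × Finset I,
      (Dom r e.1 e.2 ∧ e.1.card = e.2.card ∧ Inc (τ, D) e) ↔ (e = a ∨ e = b) := by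
  have hex : ∀ i, ∃ x ∈ τ, ∀ y ∈ τ, r i x ≤ r i y := fun i => exists_min_image τ (r i) hne
  choose m hmm hm using hex
  obtain ⟨i, hi, j, hj, hij, hmij⟩ := exists_ne_map_eq_of_card_lt_of_maps_to
    (s := D) (t := τ) (by omega) (f := m) (fun a _ => hmm a)
  have hmin : ∀ l, ∀ x ∈ τ, (∀ y ∈ τ, r l x ≤ r l y) → m l = x := by
    intro l x hx h
    exact hr l (le_antisymm (hm l x hx) (h _ (hmm l)))
  have hsurj : ∀ x ∈ τ, ∃ l ∈ D, m l = x := by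
    intro x hx
    obtain ⟨l, hl, h⟩ := hD x
    exact ⟨l, hl, hmin l x hx h⟩
  have hsi : ∀ x ∈ τ, ∃ l ∈ D.erase i, m l = x := by
    intro x hx
    obtain ⟨l, hl, h⟩ := hsurj x hx
    by_cases hli : l = i
    · exact ⟨j, mem_erase.2 ⟨hij.symm, hj⟩, by rw [← hmij, ← hli, h]⟩
    · exact ⟨l, mem_erase.2 ⟨hli, hl⟩, h⟩
  have hsj : ∀ x ∈ τ, ∃ l ∈ D.erase j, m l = x := by
    intro x hx
    obtain ⟨l, hl, h⟩ := hsurj x hx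
    by_cases hli : l = j
    · exact ⟨i, mem_erase.2 ⟨hij, hi⟩, by rw [hmij, ← hli, h]⟩
    · exact ⟨l, mem_erase.2 ⟨hli, hl⟩, h⟩
  -- if `D.erase k` still maps onto `τ`, the map is injective there
  have hinj : ∀ k ∈ D, (∀ x ∈ τ, ∃ l ∈ D.erase k, m l = x) →
      Set.InjOn m (D.erase k : Finset I) := by
    intro k hk hs
    rw [← card_image_iff]
    have : (D.erase k).image m = τ := by
      ext x
      constructor
      · intro hx
        obtain ⟨l, _, rfl⟩ := mem_image.1 hx
        exact hmm l
      · intro hx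
        obtain ⟨l, hl, h⟩ := hs x hx
        exact mem_image.2 ⟨l, hl, h⟩
    rw [this, card_erase_of_mem hk, hcard]
    omega
  have hkij : ∀ k ∈ D, (∀ x ∈ τ, ∃ l ∈ D.erase k, m l = x) → k = i ∨ k = j := by
    intro k hk hs
    by_contra hcon
    push Not at hcon
    exact hij (hinj k hk hs (mem_coe.2 (mem_erase.2 ⟨hcon.1.symm, hi⟩))
      (mem_coe.2 (mem_erase.2 ⟨hcon.2.symm, hj⟩)) hmij)
  obtain ⟨a, hta, hda, hca⟩ := typ_exists r m τ D hmm hm hD hcard i hi hsi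
  obtain ⟨b, htb, hdb, hcb⟩ := typ_exists r m τ D hmm hm hD hcard j hj hsj
  have hinc : ∀ k ∈ D, ∀ e, Typ r m τ D k e → Inc (τ, D) e := by
    intro k hk e he
    rcases he with ⟨h1, h2⟩ | ⟨h1, y, hy, h2, _⟩
    · exact Or.inr ⟨h1, k, by rw [h2]; simp, by rw [h2]; exact (insert_erase hk).symm⟩
    · exact Or.inl ⟨h1.symm, y, hy, h2⟩
  refine ⟨a, b, ?_, ?_⟩
  · rintro rfl
    rcases hta with ⟨h1, h2⟩ | ⟨h1, y, hy, h2, hlt⟩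
    · rcases htb with ⟨h1', h2'⟩ | ⟨h1', y', hy', h2', hlt'⟩
      · have : i ∈ D.erase j := mem_erase.2 ⟨hij, hi⟩
        rw [← h2', h2] at this
        simp at this
      · rw [h1'] at h2
        rw [h2] at hi
        simp at hi
    · rcases htb with ⟨h1', h2'⟩ | ⟨h1', y', hy', h2', hlt'⟩
      · rw [h1] at h2'
        rw [h2'] at hj
        simp at hj
      · have hyy : y = y' := by
          have : y ∈ insert y' τ := by rw [← h2', h2]; simp
          rcases mem_insert.1 this with h | h
          · exact h
          · exact absurd h hy
        subst hyy
        obtain ⟨l, hl, hx⟩ := hD y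
        have h3 := hx (m l) (hmm l)
        by_cases hli : l = i
        · have := hlt' l (mem_erase.2 ⟨hli ▸ hij, hl⟩)
          omega
        · have := hlt l (mem_erase.2 ⟨hli, hl⟩)
          omega
  · intro e
    constructor
    · rintro ⟨hde, hce, hie⟩
      have htyp : ∃ k ∈ D, (k = i ∨ k = j) ∧ Typ r m τ D k e := by
        rcases hie with ⟨h1, y, hy, h2⟩ | ⟨h1, k, hk, h2⟩
        · simp only at h1 hy h2
          rw [← h1, h2] at hde
          obtain ⟨k, hk, hkmin⟩ := hde y
          have hs' : ∀ x ∈ τ, ∃ l ∈ D.erase k, m l = x ∧ r l x ≤ r l y := by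
            intro x hx
            obtain ⟨l, hl, hlx⟩ := hde x
            refine ⟨l, mem_erase.2 ⟨?_, hl⟩,
              hmin l x hx (fun z hz => hlx z (mem_insert_of_mem hz)), hlx y (mem_insert_self _ _)⟩
            rintro rfl
            have : x = y := hr l (le_antisymm (hlx y (mem_insert_self _ _))
              (hkmin x (mem_insert_of_mem hx)))
            exact hy (this ▸ hx)
          have hs : ∀ x ∈ τ, ∃ l ∈ D.erase k, m l = x := fun x hx => by
            obtain ⟨l, hl, h, _⟩ := hs' x hx
            exact ⟨l, hl, h⟩
          refine ⟨k, hk, hkij k hk hs, Or.inr ⟨h1.symm, y, hy, h2, ?_⟩⟩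
          intro l hl
          obtain ⟨l', hl', he, hle⟩ := hs' (m l) (hmm l)
          have : l' = l := hinj k hk hs (mem_coe.2 hl') (mem_coe.2 hl) he
          subst this
          refine lt_of_le_of_ne hle ?_
          intro heq
          exact hy (hr _ heq ▸ hmm _)
        · simp only at h1 h2
          have hkD : k ∈ D := by rw [h2]; simp
          have hCe : e.2 = D.erase k := by rw [h2, erase_insert hk]
          rw [h1, hCe] at hde
          refine ⟨k, hkD, hkij k hkD ?_, Or.inl ⟨h1, hCe⟩⟩
          intro x hx
          obtain ⟨l, hl, h⟩ := hde x
          exact ⟨l, hl, hmin l x hx h⟩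
      obtain ⟨k, hk, hk' | hk', ht⟩ := htyp
      · subst hk'
        exact Or.inl (typ_unique r hr m τ D hmm k hk e a ht hta hde hda)
      · subst hk'
        exact Or.inr (typ_unique r hr m τ D hmm k hk e b ht htb hde hdb)
    · rintro (rfl | rfl)
      · exact ⟨hda, hca, hinc i hi _ hta⟩
      · exact ⟨hdb, hcb, hinc j hj _ htb⟩

lemma door_one [Nonempty T] (r : I → T → ℕ) (hr : ∀ i, Function.Injective (r i)) (i : I) :
    ∃ a : Finset T × Finset I, ∀ e : Finset T × Finset I,
      (Dom r e.1 e.2 ∧ e.1.card = e.2.card ∧ Inc ((∅ : Finset T), ({i} : Finset I)) e) ↔ e = a := by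
  obtain ⟨y, _, hy⟩ := exists_max_image (univ : Finset T) (r i) univ_nonempty
  refine ⟨({y}, {i}), ?_⟩
  intro e
  constructor
  · rintro ⟨hd, hc, hi⟩
    rcases hi with ⟨h1, x, hx, h2⟩ | ⟨h1, k, hk, h2⟩
    · simp only at h1 h2
      have h2' : e.1 = {x} := by rw [h2]; rfl
      rw [← h1, h2'] at hd
      obtain ⟨l, hl, h⟩ := hd y
      rw [mem_singleton] at hl
      subst hl
      have : x = y := hr l (le_antisymm (hy x (mem_univ _)) (h x (mem_singleton_self _)))
      ext1
      · rw [h2', this]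
      · exact h1.symm
    · simp only at h1 h2
      rw [h1] at hc
      have : e.2 = ∅ := by rw [← card_eq_zero, ← hc]; rfl
      rw [this] at hd
      obtain ⟨l, hl, _⟩ := hd y
      simp at hl
  · rintro rfl
    refine ⟨?_, by simp, Or.inl ⟨rfl, y, by simp, rfl⟩⟩
    intro z
    refine ⟨i, by simp, ?_⟩
    intro x hx
    rw [mem_singleton.1 hx]
    exact hy z (mem_univ _)

/-- A good door for the colouring `c` and the distinguished index `i0`. -/
def Good (c : T → I) (i0 : I) (d : Finset T × Finset I) : Prop :=
  d.2.card = d.1.card + 1 ∧ i0 ∈ d.2 ∧ d.1.image c = d.2.erase i0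

lemma room_even (c : T → I) (i0 : I) (e : Finset T × Finset I)
    (hc : e.1.card = e.2.card) (hcol : e.1.image c ≠ e.2) :
    (∀ d, ¬ (Good c i0 d ∧ Inc d e)) ∨
    ∃ a b : Finset T × Finset I, a ≠ b ∧ ∀ d, (Good c i0 d ∧ Inc d e) ↔ (d = a ∨ d = b) := by
  obtain ⟨σ, C⟩ := e
  simp only at hc hcol
  by_cases hX : i0 ∈ C ∧ ∃ x ∈ σ, (σ.erase x).image c = C.erase i0
  · right
    obtain ⟨hi0, x, hx, hxe⟩ := hX
    have himg : σ.image c = insert (c x) (C.erase i0) := by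
      rw [← hxe, ← image_insert, insert_erase hx]
    have hk0 : c x ≠ i0 := by
      intro h
      apply hcol
      rw [himg, h, insert_erase hi0]
    have hcardpos := card_pos.2 ⟨x, hx⟩
    have hinjx : Set.InjOn c (σ.erase x : Finset T) := by
      rw [← card_image_iff, hxe, card_erase_of_mem hi0, card_erase_of_mem hx, hc]
    -- description of good doors of the first kind
    have hgood : ∀ z ∈ σ, (σ.erase z).image c = C.erase i0 →
        Good c i0 (σ.erase z, C) ∧ Inc (σ.erase z, C) (σ, C) := by
      intro z hz hze
      refine ⟨⟨?_, hi0, hze⟩, Or.inl ⟨rfl, z, by simp, (insert_erase hz).symm⟩⟩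
      simp only [card_erase_of_mem hz]
      omega
    by_cases hkC : c x ∈ C
    · have : c x ∈ (σ.erase x).image c := by
        rw [hxe]; exact mem_erase.2 ⟨hk0, hkC⟩
      obtain ⟨x', hx', hcx⟩ := mem_image.1 this
      have hxx : x' ≠ x := (mem_erase.1 hx').1
      have hx's : x' ∈ σ := (mem_erase.1 hx').2
      have hsig : σ.image c = C.erase i0 := by
        rw [himg]; exact insert_eq_of_mem (mem_erase.2 ⟨hk0, hkC⟩)
      have hx'e : (σ.erase x').image c = C.erase i0 := by
        rw [← hsig]
        apply Subset.antisymm (image_subset_image (erase_subset _ _))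
        intro w hw
        obtain ⟨z, hz, rfl⟩ := mem_image.1 hw
        by_cases hzx : z = x'
        · exact mem_image.2 ⟨x, mem_erase.2 ⟨hxx.symm, hx⟩, by rw [hzx, hcx]⟩
        · exact mem_image.2 ⟨z, mem_erase.2 ⟨hzx, hz⟩, rfl⟩
      refine ⟨(σ.erase x, C), (σ.erase x', C), ?_, ?_⟩
      · intro h
        have h1 : σ.erase x = σ.erase x' := congrArg Prod.fst h
        rw [← h1] at hx'e
        have : x' ∈ σ.erase x' := by rw [← h1]; exact hx'
        simp at this
      · rintro ⟨τ, D⟩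
        constructor
        · rintro ⟨⟨hg1, hg2, hg3⟩, ⟨h1, z, hz, h2⟩ | ⟨h1, k, hk, h2⟩⟩
          · simp only at hg1 hg2 hg3 h1 hz h2
            subst h1
            have hτ : τ = σ.erase z := by rw [h2, erase_insert hz]
            have hzs : z ∈ σ := by rw [h2]; simp
            by_cases hzx : z = x
            · left; rw [hτ, hzx]
            · right
              have hxz : x ∈ τ := by rw [hτ]; exact mem_erase.2 ⟨Ne.symm hzx, hx⟩
              by_cases hzx' : z = x'
              · rw [hτ, hzx']
              · exfalso
                -- then `c` is injective on `σ.erase z`, containing both `x` and `x'`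
                have hinjz : Set.InjOn c (τ : Finset T) := by
                  rw [← card_image_iff, hg3, card_erase_of_mem hg2, hg1]
                  omega
                have hx'z : x' ∈ τ := by rw [hτ]; exact mem_erase.2 ⟨Ne.symm hzx', hx's⟩
                exact hxx (hinjz (mem_coe.2 hx'z) (mem_coe.2 hxz) hcx)
          · exfalso
            simp only at hg1 hg2 hg3 h1 hk h2
            subst h1
            have h3 : k ∈ σ.image c := by
              rw [hg3, h2]
              refine mem_erase.2 ⟨?_, mem_insert_self _ _⟩
              rintro rfl
              exact hk hi0
            rw [hsig] at h3
            exact hk (mem_erase.1 h3).2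
        · rintro (h | h)
          · rw [h]; exact hgood x hx hxe
          · rw [h]; exact hgood x' hx's hx'e
    · refine ⟨(σ.erase x, C), (σ, insert (c x) C), ?_, ?_⟩
      · intro h
        have h1 : C = insert (c x) C := congrArg Prod.snd h
        exact hkC (by rw [h1]; simp)
      · have hinj : Set.InjOn c (σ : Finset T) := by
          rw [← card_image_iff, himg, card_insert_of_notMem, card_erase_of_mem hi0, hc]
          · omega
          · intro h; exact hkC (mem_erase.1 h).2
        rintro ⟨τ, D⟩
        constructor
        · rintro ⟨⟨hg1, hg2, hg3⟩, ⟨h1, z, hz, h2⟩ | ⟨h1, k, hk, h2⟩⟩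
          · simp only at hg1 hg2 hg3 h1 hz h2
            subst h1
            have hτ : τ = σ.erase z := by rw [h2, erase_insert hz]
            left
            by_cases hzx : z = x
            · rw [hτ, hzx]
            · exfalso
              have hxz : x ∈ τ := by rw [hτ]; exact mem_erase.2 ⟨Ne.symm hzx, hx⟩
              have : c x ∈ D.erase i0 := by rw [← hg3]; exact mem_image_of_mem _ hxz
              exact hkC (mem_erase.1 this).2
          · simp only at hg1 hg2 hg3 h1 hk h2
            subst h1
            right
            have : c x ∈ D.erase i0 := by rw [← hg3]; exact mem_image_of_mem _ hx
            have := (mem_erase.1 this).2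
            rw [h2] at this
            rcases mem_insert.1 this with h | h
            · rw [h2, h]
            · exact absurd h hkC
        · rintro (h | h)
          · rw [h]; exact hgood x hx hxe
          · rw [h]
            refine ⟨⟨?_, mem_insert_of_mem hi0, ?_⟩, Or.inr ⟨rfl, c x, hkC, rfl⟩⟩
            · simp only [card_insert_of_notMem hkC, hc]
            · simp only
              rw [himg, erase_insert_of_ne hk0]
  · left
    rintro ⟨τ, D⟩ ⟨⟨hg1, hg2, hg3⟩, ⟨h1, z, hz, h2⟩ | ⟨h1, k, hk, h2⟩⟩
    · simp only at hg1 hg2 hg3 h1 hz h2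
      subst h1
      refine hX ⟨hg2, z, by rw [h2]; simp, ?_⟩
      rw [h2, erase_insert hz, hg3]
    · simp only at hg1 hg2 hg3 h1 hk h2
      subst h1
      have hk0 : k ≠ i0 := by
        rintro rfl
        apply hcol
        rw [hg3, h2, erase_insert hk]
      have hi0 : i0 ∈ C := by
        rw [h2] at hg2
        rcases mem_insert.1 hg2 with h | h
        · exact absurd h.symm hk0
        · exact h
      have hinj : Set.InjOn c (σ : Finset T) := by
        rw [← card_image_iff, hg3, card_erase_of_mem hg2, hg1]
        omega
      have hkm : k ∈ σ.image c := by
        rw [hg3, h2]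
        exact mem_erase.2 ⟨hk0, mem_insert_self _ _⟩
      obtain ⟨x, hx, hcx⟩ := mem_image.1 hkm
      refine hX ⟨hi0, x, hx, ?_⟩
      ext w
      constructor
      · intro hw
        obtain ⟨z, hz, rfl⟩ := mem_image.1 hw
        have h3 : c z ∈ D.erase i0 := by
          rw [← hg3]; exact mem_image_of_mem _ (mem_erase.1 hz).2
        rw [h2] at h3
        refine mem_erase.2 ⟨(mem_erase.1 h3).1, ?_⟩
        rcases mem_insert.1 (mem_erase.1 h3).2 with h | h
        · exfalso
          exact (mem_erase.1 hz).1 (hinj (mem_coe.2 (mem_erase.1 hz).2) (mem_coe.2 hx)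
            (by rw [h, hcx]))
        · exact h
      · intro hw
        have h3 : w ∈ σ.image c := by
          rw [hg3, h2]
          exact mem_erase.2 ⟨(mem_erase.1 hw).1, mem_insert_of_mem (mem_erase.1 hw).2⟩
        obtain ⟨z, hz, rfl⟩ := mem_image.1 h3
        refine mem_image.2 ⟨z, mem_erase.2 ⟨?_, hz⟩, rfl⟩
        rintro rfl
        rw [hcx] at hw
        exact hk (mem_erase.1 hw).2

/-- Scarf's lemma: there is a colourful dominant pair. -/
theorem scarf [Nonempty T] (r : I → T → ℕ) (hr : ∀ i, Function.Injective (r i))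
    (c : T → I) : ∃ σ : Finset T, Dom r σ (σ.image c) := by
  classical
  by_contra hcon
  push Not at hcon
  obtain ⟨t0⟩ := ‹Nonempty T›
  have : Nonempty T := ⟨t0⟩
  let i0 : I := c t0
  let Gd : Finset (Finset T × Finset I) := univ.filter (fun d => Dom r d.1 d.2 ∧ Good c i0 d)
  let Rm : Finset (Finset T × Finset I) :=
    univ.filter (fun e => Dom r e.1 e.2 ∧ e.1.card = e.2.card)
  have hsum := sum_card_bipartiteAbove_eq_sum_card_bipartiteBelow (s := Gd) (t := Rm) Inc
  have hR : Even (∑ b ∈ Rm, (Gd.bipartiteBelow Inc b).card) := by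
    apply even_sum
    intro e he
    obtain ⟨hde, hce⟩ := (mem_filter.1 he).2
    have hcol : e.1.image c ≠ e.2 := by
      intro h
      exact hcon e.1 (h ▸ hde)
    have hmem : ∀ d, d ∈ Gd.bipartiteBelow Inc e ↔ (Good c i0 d ∧ Inc d e) := by
      intro d
      simp only [bipartiteBelow, mem_filter, mem_univ, true_and, Gd]
      constructor
      · rintro ⟨⟨_, h⟩, h'⟩; exact ⟨h, h'⟩
      · rintro ⟨h, h'⟩
        refine ⟨⟨?_, h⟩, h'⟩
        rcases h' with ⟨h1, x, hx, h2⟩ | ⟨h1, x, hx, h2⟩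
        · exact hde.mono (by rw [h2]; exact subset_insert _ _) (by rw [h1])
        · exact hde.mono (by rw [h1]) (by rw [h2]; exact subset_insert _ _)
    rcases room_even c i0 e hce hcol with h | ⟨a, b, hab, h⟩
    · have : Gd.bipartiteBelow Inc e = ∅ := by
        ext d; rw [hmem]; simp only [notMem_empty, iff_false]; exact h d
      rw [this]; simp
    · have : Gd.bipartiteBelow Inc e = {a, b} := by
        ext d; rw [hmem, h]; simp
      rw [this, card_pair hab]
      exact even_two
  have hmemR : ∀ d e, e ∈ Rm.bipartiteAbove Inc d ↔
      (Dom r e.1 e.2 ∧ e.1.card = e.2.card ∧ Inc d e) := by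
    intro d e
    simp only [bipartiteAbove, mem_filter, mem_univ, true_and, Rm, and_assoc]
  have h0 : ((∅ : Finset T), ({i0} : Finset I)) ∈ Gd := by
    simp only [Gd, mem_filter, mem_univ, true_and]
    refine ⟨?_, by simp, by simp, by simp⟩
    intro y
    exact ⟨i0, by simp, by simp⟩
  rw [← add_sum_erase _ _ h0] at hsum
  have h1 : (Rm.bipartiteAbove Inc ((∅ : Finset T), ({i0} : Finset I))).card = 1 := by
    obtain ⟨a, ha⟩ := door_one r hr i0
    rw [card_eq_one]
    refine ⟨a, ?_⟩
    ext e
    rw [hmemR, ha, mem_singleton]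
  have h2 : Even (∑ d ∈ Gd.erase ((∅ : Finset T), ({i0} : Finset I)),
      (Rm.bipartiteAbove Inc d).card) := by
    apply even_sum
    rintro ⟨τ, D⟩ hd
    obtain ⟨hd1, hd2⟩ := mem_erase.1 hd
    obtain ⟨hdom, hg1, hg2, hg3⟩ := (mem_filter.1 hd2).2
    simp only at hdom hg1 hg2 hg3
    have hne : τ.Nonempty := by
      by_contra hemp
      rw [not_nonempty_iff_eq_empty] at hemp
      subst hemp
      apply hd1
      simp only [card_empty, zero_add] at hg1
      obtain ⟨w, hw⟩ := card_eq_one.1 hg1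
      rw [hw, mem_singleton] at hg2
      rw [hw, hg2]
    obtain ⟨a, b, hab, h⟩ := door_two r hr τ D hne hdom hg1
    have : Rm.bipartiteAbove Inc (τ, D) = {a, b} := by
      ext e; rw [hmemR, h]; simp
    rw [this, card_pair hab]
    exact even_two
  rw [h1] at hsum
  rw [← hsum] at hR
  obtain ⟨p, hp⟩ := hR
  obtain ⟨q, hq⟩ := h2
  omega

end ScarfAux

namespace RoundAux

/-- Mixed rows. -/
lemma round_aux {P J : Type*} [Fintype P] [DecidableEq P] [Fintype J] [DecidableEq J]
    (N : ℕ) : ∀ (ρ : P → J → ℝ), (∀ p j, 0 ≤ ρ p j) → (∀ p, ∑ j, ρ p j = 1) →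
    (univ.filter (fun z : P × J => ρ z.1 z.2 ≠ 0)).card ≤ N →
    ∃ ρ' : P → J → ℝ, (∀ p j, 0 ≤ ρ' p j) ∧ (∀ p, ∑ j, ρ' p j = 1) ∧
      (∀ j, ∑ p, ρ' p j = ∑ p, ρ p j) ∧ (∀ p j, ρ p j = 0 → ρ' p j = 0) ∧
      (univ.filter (fun p => ¬ ∃ j, ρ' p j = 1)).card ≤ Fintype.card J := by
  classical
  induction N with
  | zero =>
    intro ρ h0 h1 hN
    refine ⟨ρ, h0, h1, fun _ => rfl, fun _ _ h => h, ?_⟩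
    have hz : ∀ p j, ρ p j = 0 := by
      intro p j
      by_contra h
      have : (p, j) ∈ (univ.filter (fun z : P × J => ρ z.1 z.2 ≠ 0)) := by simp [h]
      have := card_pos.2 ⟨_, this⟩
      omega
    have : (univ.filter (fun p => ¬ ∃ j, ρ p j = 1)) = (∅ : Finset P) := by
      ext p
      have := h1 p
      simp [hz] at this
    rw [this]; simp
  | succ N ih =>
    intro ρ h0 h1 hN
    by_cases hM : (univ.filter (fun p => ¬ ∃ j, ρ p j = 1)).card ≤ Fintype.card J
    · exact ⟨ρ, h0, h1, fun _ => rfl, fun _ _ h => h, hM⟩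
    rw [not_le] at hM
    set M := (univ.filter (fun p => ¬ ∃ j, ρ p j = 1)) with hMdef
    have hab : ∀ p : M, ∃ a b, a ≠ b ∧ 0 < ρ p a ∧ 0 < ρ p b := by
      rintro ⟨p, hp⟩
      simp only [hMdef, mem_filter, mem_univ, true_and, not_exists] at hp
      obtain ⟨a, -, ha⟩ : ∃ a ∈ (univ : Finset J), 0 < ρ p a := by
        by_contra hc
        push Not at hc
        have := sum_nonpos hc
        rw [h1 p] at this
        linarith
      refine ⟨a, ?_⟩
      by_contra hc
      push Not at hc
      apply hp a
      rw [← h1 p]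
      symm
      apply sum_eq_single_of_mem a (mem_univ _)
      intro b _ hb
      exact le_antisymm (hc b hb.symm ha) (h0 p b)
    choose a b hne ha hb using hab
    let v : M → J → ℝ := fun p => Pi.single (a p) 1 - Pi.single (b p) 1
    have hnl : ¬ LinearIndependent ℝ v := by
      intro h
      have := h.fintype_card_le_finrank
      rw [Module.finrank_pi, Fintype.card_coe] at this
      omega
    rw [Fintype.not_linearIndependent_iff] at hnl
    obtain ⟨g, hg, p0, hp0⟩ := hnl
    let d : P → J → ℝ := fun p j => if h : p ∈ M then g ⟨p, h⟩ * v ⟨p, h⟩ j else 0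
    have hdrow : ∀ p, ∑ j, d p j = 0 := by
      intro p
      by_cases h : p ∈ M
      · simp only [d, h, dif_pos, v, Pi.sub_apply, ← mul_sum, sum_sub_distrib]
        simp
      · simp [d, h]
    have hdcol : ∀ j, ∑ p, d p j = 0 := by
      intro j
      have h := congrFun hg j
      simp only [Finset.sum_apply, Pi.smul_apply, smul_eq_mul, Pi.zero_apply] at h
      rw [← h]
      have : ∑ p, d p j = ∑ p ∈ M, d p j := by
        symm
        apply sum_subset (subset_univ _)
        intro p _ hp
        simp [d, hp]
      rw [this, ← sum_coe_sort M]
      apply sum_congr rfl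
      rintro ⟨p, hp⟩ _
      simp [d, hp]
    have hdsupp : ∀ p j, d p j ≠ 0 → 0 < ρ p j := by
      intro p j hd
      by_cases h : p ∈ M
      · simp only [d, h, dif_pos, v, Pi.sub_apply] at hd
        by_cases hja : j = a ⟨p, h⟩
        · rw [hja]; exact ha ⟨p, h⟩
        · by_cases hjb : j = b ⟨p, h⟩
          · rw [hjb]; exact hb ⟨p, h⟩
          · simp [hja, hjb] at hd
      · simp [d, h] at hd
    have hdne : d p0 (a p0) ≠ 0 := by
      simp only [d, p0.2, dif_pos, v, Pi.sub_apply]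
      simp [hp0, hne p0]
    obtain ⟨j0, hj0⟩ : ∃ j, d p0 j < 0 := by
      by_contra hc
      push Not at hc
      have := (sum_eq_zero_iff_of_nonneg (fun j _ => hc j)).1 (hdrow p0) (a p0) (mem_univ _)
      exact hdne this
    obtain ⟨z, hz, hzmin⟩ := exists_min_image
      (univ.filter (fun z : P × J => d z.1 z.2 < 0)) (fun z => ρ z.1 z.2 / (-d z.1 z.2))
      ⟨(p0, j0), by simp [hj0]⟩
    simp only [mem_filter, mem_univ, true_and] at hz hzmin
    set t := ρ z.1 z.2 / (-d z.1 z.2) with ht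
    have ht0 : 0 ≤ t := div_nonneg (h0 _ _) (by linarith)
    let ρ1 : P → J → ℝ := fun p j => ρ p j + t * d p j
    have h10 : ∀ p j, 0 ≤ ρ1 p j := by
      intro p j
      simp only [ρ1]
      by_cases hd : d p j < 0
      · have := hzmin (p, j) hd
        simp only at this
        rw [le_div_iff₀ (by linarith)] at this
        linarith
      · push Not at hd
        have := mul_nonneg ht0 hd
        have := h0 p j
        linarith
    have h11 : ∀ p, ∑ j, ρ1 p j = 1 := by
      intro p
      simp only [ρ1, sum_add_distrib, ← mul_sum, hdrow, h1]
      simp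
    have h1c : ∀ j, ∑ p, ρ1 p j = ∑ p, ρ p j := by
      intro j
      simp only [ρ1, sum_add_distrib, ← mul_sum, hdcol]
      simp
    have h1s : ∀ p j, ρ p j = 0 → ρ1 p j = 0 := by
      intro p j h
      have : d p j = 0 := by
        by_contra hd
        have := hdsupp p j hd
        linarith
      simp [ρ1, h, this]
    have hz1 : ρ1 z.1 z.2 = 0 := by
      simp only [ρ1, ht]
      have : d z.1 z.2 ≠ 0 := hz.ne
      field_simp
      ring
    have hlt : (univ.filter (fun z : P × J => ρ1 z.1 z.2 ≠ 0)).card <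
        (univ.filter (fun z : P × J => ρ z.1 z.2 ≠ 0)).card := by
      apply card_lt_card
      rw [ssubset_iff_of_subset]
      · refine ⟨z, ?_, ?_⟩
        · simp only [mem_filter, mem_univ, true_and]
          exact (hdsupp _ _ hz.ne).ne'
        · simp [hz1]
      · intro w
        simp only [mem_filter, mem_univ, true_and]
        intro hw hw'
        exact hw (h1s _ _ hw')
    obtain ⟨ρ', e1, e2, e3, e4, e5⟩ := ih ρ1 h10 h11 (by omega)
    exact ⟨ρ', e1, e2, fun j => (e3 j).trans (h1c j), fun p j h => e4 p j (h1s p j h), e5⟩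

lemma rounding {P J : Type*} [Fintype P] [DecidableEq P] [Fintype J] [DecidableEq J]
    (ρ : P → J → ℝ) (h0 : ∀ p j, 0 ≤ ρ p j) (h1 : ∀ p, ∑ j, ρ p j = 1) :
    ∃ S : P → J, (∀ p, 0 < ρ p (S p)) ∧
      ∑ j, |((univ.filter (fun q => S q = j)).card : ℝ) - ∑ p, ρ p j| ≤
        2 * (Fintype.card J : ℝ) := by
  classical
  obtain ⟨ρ', e1, e2, e3, e4, e5⟩ := round_aux _ ρ h0 h1 le_rfl
  have hS : ∀ p, ∃ j, 0 < ρ' p j ∧ ((∃ j, ρ' p j = 1) → ρ' p j = 1) := by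
    intro p
    by_cases h : ∃ j, ρ' p j = 1
    · obtain ⟨j, hj⟩ := h
      exact ⟨j, by rw [hj]; exact one_pos, fun _ => hj⟩
    · obtain ⟨a, -, ha⟩ : ∃ a ∈ (univ : Finset J), 0 < ρ' p a := by
        by_contra hc
        push Not at hc
        have := sum_nonpos hc
        rw [e2 p] at this
        linarith
      exact ⟨a, ha, fun h' => absurd h' h⟩
  choose S hS1 hS2 using hS
  refine ⟨S, ?_, ?_⟩
  · intro p
    refine lt_of_le_of_ne (h0 _ _) ?_
    intro h
    have := e4 p (S p) h.symm
    have := hS1 p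
    linarith
  · have hcount : ∀ j, ((univ.filter (fun q => S q = j)).card : ℝ) =
        ∑ p, if S p = j then (1 : ℝ) else 0 := by
      intro j; simp
    have hrow : ∀ p, ∑ j, |(if S p = j then (1 : ℝ) else 0) - ρ' p j| ≤
        if (¬ ∃ j, ρ' p j = 1) then 2 else 0 := by
      intro p
      have hle : ∑ j, |(if S p = j then (1 : ℝ) else 0) - ρ' p j| ≤
          ∑ j, ((if S p = j then (1 : ℝ) else 0) + ρ' p j -
            2 * (if S p = j then ρ' p j else 0)) := by
        apply sum_le_sum
        intro j _
        have hle1 : ρ' p j ≤ 1 := by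
          rw [← e2 p]; exact single_le_sum (fun j _ => e1 p j) (mem_univ j)
        have := e1 p j
        split_ifs
        · rw [abs_of_nonneg (by linarith)]; linarith
        · rw [abs_of_nonpos (by linarith)]; linarith
      rw [sum_sub_distrib, sum_add_distrib, ← mul_sum, e2] at hle
      simp only [sum_ite_eq, mem_univ, if_true] at hle
      by_cases h : ∃ j, ρ' p j = 1
      · rw [if_neg (not_not.2 h)]
        have := hS2 p h
        linarith
      · rw [if_pos h]
        have := e1 p (S p)
        linarith
    calc ∑ j, |((univ.filter (fun q => S q = j)).card : ℝ) - ∑ p, ρ p j|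
        = ∑ j, |∑ p, ((if S p = j then (1 : ℝ) else 0) - ρ' p j)| := by
          apply sum_congr rfl
          intro j _
          rw [hcount, ← e3, sum_sub_distrib]
      _ ≤ ∑ j, ∑ p, |(if S p = j then (1 : ℝ) else 0) - ρ' p j| :=
          sum_le_sum (fun j _ => abs_sum_le_sum_abs _ _)
      _ = ∑ p, ∑ j, |(if S p = j then (1 : ℝ) else 0) - ρ' p j| := sum_comm
      _ ≤ ∑ p, if (¬ ∃ j, ρ' p j = 1) then (2 : ℝ) else 0 := sum_le_sum (fun p _ => hrow p)
      _ = 2 * ((univ.filter (fun p => ¬ ∃ j, ρ' p j = 1)).card : ℝ) := by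
          rw [← sum_filter, sum_const, nsmul_eq_mul, mul_comm]
      _ ≤ _ := by
          have : ((univ.filter (fun p => ¬ ∃ j, ρ' p j = 1)).card : ℝ) ≤ Fintype.card J := by
            exact_mod_cast e5
          linarith

end RoundAux

namespace BrouwerAux

open ScarfAux

/-- The lattice simplex. -/
abbrev Lat (s N : ℕ) := {y : Fin s → ℕ // y ∈ piAntidiag (univ : Finset (Fin s)) N}

/-- Combinatorial core: a colouring of the lattice simplex has a small cell in which every
colour that matters appears. -/
lemma cell (s N : ℕ) (hs : 0 < s)
    (c : Lat s N → Fin s) :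
    ∃ σ : Finset (Lat s N), σ.Nonempty ∧
      (∀ x ∈ σ, ∀ x' ∈ σ, ∀ j, x.1 j ≤ x'.1 j + s) ∧
      (∀ x ∈ σ, ∀ j, (∃ x' ∈ σ, c x' = j) ∨ x.1 j ≤ s) := by
  classical
  have hsumT : ∀ y : Lat s N, ∑ j, y.1 j = N := fun y => (mem_piAntidiag.1 y.2).1
  have mk : ∀ y : Fin s → ℕ, ∑ j, y j = N → ∃ z : Lat s N, z.1 = y := by
    intro y hy
    exact ⟨⟨y, mem_piAntidiag.2 ⟨hy, fun i _ => mem_univ i⟩⟩, rfl⟩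
  have hne : Nonempty (Lat s N) := by
    obtain ⟨z, _⟩ := mk (Pi.single ⟨0, hs⟩ N) (by simp)
    exact ⟨z⟩
  let e := Fintype.equivFin (Lat s N)
  let M := Fintype.card (Lat s N)
  let r : Fin s → Lat s N → ℕ := fun i y => y.1 i * M + e y
  have hlt : ∀ y, (e y : ℕ) < M := fun y => (e y).2
  have hmono : ∀ i (x y : Lat s N), r i y ≤ r i x → y.1 i ≤ x.1 i := by
    intro i x y h
    by_contra hc
    push Not at hc
    have h1 : (x.1 i + 1) * M ≤ y.1 i * M := Nat.mul_le_mul_right M hc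
    have h2 := hlt x
    simp only [r] at h
    rw [add_mul] at h1
    omega
  have hinj : ∀ i, Function.Injective (r i) := by
    intro i x y h
    have h1 : x.1 i = y.1 i := le_antisymm (hmono i y x h.le) (hmono i x y h.ge)
    simp only [r, h1] at h
    have : (e x : ℕ) = e y := by omega
    exact e.injective (Fin.ext this)
  obtain ⟨σ, hσ⟩ := scarf r hinj c
  have hσne : σ.Nonempty := by
    obtain ⟨y⟩ := hne
    obtain ⟨i, hi, _⟩ := hσ y
    obtain ⟨x, hx, _⟩ := mem_image.1 hi
    exact ⟨x, hx⟩
  set C := σ.image c with hC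
  have hex : ∀ i, ∃ x ∈ σ, ∀ y ∈ σ, x.1 i ≤ y.1 i := fun i =>
    exists_min_image σ (fun x => x.1 i) hσne
  choose m hmm hm using hex
  have hbig : N < ∑ i ∈ C, ((m i).1 i + 1) := by
    by_contra hc
    push Not at hc
    obtain ⟨i0, hi0⟩ : C.Nonempty := hσne.image c
    obtain ⟨z, hz⟩ := mk (fun i => (if i ∈ C then (m i).1 i + 1 else 0) +
        (if i = i0 then N - ∑ i ∈ C, ((m i).1 i + 1) else 0)) (by
      rw [sum_add_distrib, sum_ite_eq' univ i0, ← sum_filter]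
      simp only [filter_mem_eq_inter, univ_inter, mem_univ, if_true]
      omega)
    obtain ⟨i, hi, hx⟩ := hσ z
    have h1 := hmono i _ _ (hx _ (hmm i))
    rw [hz] at h1
    simp only [hi, if_true] at h1
    omega
  have hbig' : N < ∑ i ∈ C, (m i).1 i + s := by
    rw [sum_add_distrib] at hbig
    have : C.card ≤ s := by simpa using card_le_univ C
    simp only [sum_const, smul_eq_mul, mul_one] at hbig
    omega
  have hin : ∀ x ∈ σ, ∀ j ∈ C, x.1 j ≤ (m j).1 j + s := by
    intro x hx j hj
    have h1 : ∑ i ∈ C, x.1 i ≤ N :=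
      (sum_le_univ_sum_of_nonneg (fun _ => Nat.zero_le _)).trans (hsumT x).le
    rw [← add_sum_erase C _ hj] at h1 hbig'
    have h2 : ∑ i ∈ C.erase j, (m i).1 i ≤ ∑ i ∈ C.erase j, x.1 i :=
      sum_le_sum (fun i _ => hm i x hx)
    omega
  have hout : ∀ x ∈ σ, ∀ j ∉ C, x.1 j ≤ s := by
    intro x hx j hj
    have h1 : ∑ i ∈ insert j C, x.1 i ≤ N :=
      (sum_le_univ_sum_of_nonneg (fun _ => Nat.zero_le _)).trans (hsumT x).le
    rw [sum_insert hj] at h1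
    have h2 : ∑ i ∈ C, (m i).1 i ≤ ∑ i ∈ C, x.1 i :=
      sum_le_sum (fun i _ => hm i x hx)
    omega
  refine ⟨σ, hσne, ?_, ?_⟩
  · intro x hx x' hx' j
    by_cases hj : j ∈ C
    · have := hin x hx j hj
      have := hm j x' hx'
      omega
    · have := hout x hx j hj
      omega
  · intro x hx j
    by_cases hj : j ∈ C
    · left
      exact mem_image.1 hj
    · right
      exact hout x hx j hj

/-- Approximate Brouwer fixed points on a scaled simplex. -/
theorem approx_brouwer (s n : ℕ) (hs : 0 < s)
    (f : (Fin s → ℝ) → (Fin s → ℝ)) (hf : Continuous f)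
    (hpos : ∀ x i, 0 ≤ f x i) (hsum : ∀ x, ∑ i, f x i = n) (ε : ℝ) (hε : 0 < ε) :
    ∃ x : Fin s → ℝ, ∑ i, x i = n ∧ ∀ i, x i ≤ f x i + ε := by
  classical
  have hcomp : IsCompact (Set.Icc (0 : Fin s → ℝ) (fun _ => (n : ℝ))) := isCompact_Icc
  have huc := hcomp.uniformContinuousOn_of_continuous hf.continuousOn
  rw [Metric.uniformContinuousOn_iff] at huc
  obtain ⟨δ, hδ, huc⟩ := huc (ε / 2) (by linarith)
  obtain ⟨K, hK⟩ := exists_nat_gt ((s : ℝ) / min δ (ε / 2))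
  have hmin : 0 < min δ (ε / 2) := lt_min hδ (by linarith)
  have hs' : (0 : ℝ) < s := by exact_mod_cast hs
  have hK0 : (0 : ℝ) < K := lt_trans (div_pos hs' hmin) hK
  have hsK : (s : ℝ) / K < min δ (ε / 2) := by
    rw [div_lt_iff₀ hmin] at hK
    rw [div_lt_iff₀ hK0]
    linarith
  have hsδ : (s : ℝ) / K < δ := lt_of_lt_of_le hsK (min_le_left _ _)
  have hsε : (s : ℝ) / K < ε / 2 := lt_of_lt_of_le hsK (min_le_right _ _)
  let pt : Lat s (n * K) → Fin s → ℝ :=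
    fun y i => (y.1 i : ℝ) / K
  have hptsum : ∀ y, ∑ i, pt y i = n := by
    intro y
    have h : ∑ j, y.1 j = n * K := (mem_piAntidiag.1 y.2).1
    simp only [pt, ← sum_div]
    rw [div_eq_iff hK0.ne']
    exact_mod_cast h
  have hpt0 : ∀ y i, 0 ≤ pt y i := fun y i => div_nonneg (Nat.cast_nonneg _) hK0.le
  have hptmem : ∀ y, pt y ∈ Set.Icc (0 : Fin s → ℝ) (fun _ => (n : ℝ)) := by
    intro y
    refine ⟨fun i => hpt0 y i, fun i => ?_⟩
    rw [← hptsum y]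
    exact single_le_sum (fun i _ => hpt0 y i) (mem_univ i)
  have hcol : ∀ y, ∃ i, pt y i ≤ f (pt y) i := by
    intro y
    by_contra hc
    push Not at hc
    have : ∑ i, f (pt y) i < ∑ i, pt y i :=
      sum_lt_sum_of_nonempty ⟨⟨0, hs⟩, mem_univ _⟩ (fun i _ => hc i)
    rw [hsum, hptsum] at this
    exact lt_irrefl _ this
  choose c hc using hcol
  obtain ⟨σ, ⟨x, hx⟩, h1, h2⟩ := cell s (n * K) hs c
  have hclose : ∀ x ∈ σ, ∀ x' ∈ σ, ∀ j, pt x j ≤ pt x' j + s / K := by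
    intro x hx x' hx' j
    simp only [pt]
    rw [← add_div]
    apply div_le_div_of_nonneg_right _ hK0.le
    exact_mod_cast h1 x hx x' hx' j
  refine ⟨pt x, hptsum x, ?_⟩
  intro j
  rcases h2 x hx j with ⟨x', hx', rfl⟩ | hle
  · have hd : dist (pt x') (pt x) < δ := by
      rw [dist_pi_lt_iff hδ]
      intro i
      rw [Real.dist_eq, abs_lt]
      have := hclose x hx x' hx' i
      have := hclose x' hx' x hx i
      constructor <;> linarith
    have hfd := huc _ (hptmem x') _ (hptmem x) hd
    rw [dist_pi_lt_iff (by linarith)] at hfd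
    have h3 := hfd (c x')
    rw [Real.dist_eq, abs_lt] at h3
    have h4 := hc x'
    have h5 := hclose x hx x' hx' (c x')
    linarith [h3.2]
  · have h3 : pt x j ≤ s / K := by
      simp only [pt]
      apply div_le_div_of_nonneg_right _ hK0.le
      exact_mod_cast hle
    have := hpos (pt x) j
    linarith

end BrouwerAux

namespace GameAux

/-- McShane extension of a Lipschitz function on the lattice simplex. -/
lemma extend (s N : ℕ) (hs : 0 < s) (lam : ℝ) (hlam : 0 < lam) (u : (Fin s → ℕ) → ℝ)
    (hlip : ∀ x y : Fin s → ℕ, ∑ j, x j = N → ∑ j, y j = N →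
      |u x - u y| ≤ lam * ∑ j, |(x j : ℝ) - (y j : ℝ)|) :
    ∃ U : (Fin s → ℝ) → ℝ, Continuous U ∧ ∀ (x : Fin s → ℝ) (y : Fin s → ℕ), ∑ j, y j = N →
      |U x - u y| ≤ lam * ∑ j, |x j - (y j : ℝ)| := by
  classical
  have hne : (piAntidiag (univ : Finset (Fin s)) N).Nonempty :=
    ⟨Pi.single ⟨0, hs⟩ N, mem_piAntidiag.2 ⟨by simp, fun i _ => mem_univ i⟩⟩
  refine ⟨fun x => (piAntidiag (univ : Finset (Fin s)) N).inf' hne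
    (fun y => u y + lam * ∑ j, |x j - (y j : ℝ)|), ?_, ?_⟩
  · apply Continuous.finset_inf'_apply
    intro y _
    fun_prop
  · intro x y hy
    rw [abs_le]
    constructor
    · have : u y - lam * ∑ j, |x j - (y j : ℝ)| ≤
          (piAntidiag (univ : Finset (Fin s)) N).inf' hne
            (fun y => u y + lam * ∑ j, |x j - (y j : ℝ)|) := by
        apply le_inf'
        intro z hz
        have h1 := (abs_le.1 (hlip y z hy (mem_piAntidiag.1 hz).1)).2
        have h2 : ∑ j, |(y j : ℝ) - (z j : ℝ)| ≤
            ∑ j, |x j - (y j : ℝ)| + ∑ j, |x j - (z j : ℝ)| := by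
          rw [← sum_add_distrib]
          apply sum_le_sum
          intro j _
          rw [abs_sub_comm (x j) (y j)]
          exact abs_sub_le _ _ _
        have h3 := mul_le_mul_of_nonneg_left h2 hlam.le
        rw [mul_add] at h3
        linarith
      linarith
    · have : (piAntidiag (univ : Finset (Fin s)) N).inf' hne
            (fun y => u y + lam * ∑ j, |x j - (y j : ℝ)|) ≤
            u y + lam * ∑ j, |x j - (y j : ℝ)| :=
        inf'_le (fun y : Fin s → ℕ => u y + lam * ∑ j, |x j - (y j : ℝ)|)
          (mem_piAntidiag.2 ⟨hy, fun i _ => mem_univ i⟩)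
      linarith

/-- Continuous selection of mixed strategies supported on approximate best responses. -/
lemma smooth_br (s : ℕ) (hs : 0 < s) (δ : ℝ) (hδ : 0 < δ) (U : Fin s → (Fin s → ℝ) → ℝ)
    (hU : ∀ i, Continuous (U i)) :
    ∃ ρ : (Fin s → ℝ) → Fin s → ℝ, (∀ i, Continuous (fun x => ρ x i)) ∧
      (∀ x i, 0 ≤ ρ x i) ∧ (∀ x, ∑ i, ρ x i = 1) ∧
      ∀ x i, 0 < ρ x i → ∀ j, U j x ≤ U i x + δ := by
  classical
  have hne : (univ : Finset (Fin s)).Nonempty := ⟨⟨0, hs⟩, mem_univ _⟩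
  let mx : (Fin s → ℝ) → ℝ := fun x => univ.sup' hne (fun i => U i x)
  have hmx : Continuous mx := Continuous.finset_sup'_apply hne (fun i _ => hU i)
  have hle : ∀ x i, U i x ≤ mx x := fun x i => le_sup' (fun i => U i x) (mem_univ i)
  let w : (Fin s → ℝ) → Fin s → ℝ := fun x i => max 0 (U i x - mx x + δ)
  have hw0 : ∀ x i, 0 ≤ w x i := fun x i => le_max_left _ _
  have hwc : ∀ i, Continuous (fun x => w x i) := by
    intro i
    have := hU i
    simp only [w]
    fun_prop
  have hpos : ∀ x, 0 < ∑ i, w x i := by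
    intro x
    obtain ⟨i, _, hi⟩ := exists_mem_eq_sup' hne (fun i => U i x)
    have h1 : w x i = δ := by
      simp only [w, mx, hi]
      rw [sub_self, zero_add, max_eq_right hδ.le]
    have := single_le_sum (fun i _ => hw0 x i) (mem_univ i)
    linarith
  refine ⟨fun x i => w x i / ∑ j, w x j, ?_, ?_, ?_, ?_⟩
  · intro i
    exact (hwc i).div (continuous_finsetSum _ (fun j _ => hwc j)) (fun x => (hpos x).ne')
  · intro x i
    exact div_nonneg (hw0 x i) (hpos x).le
  · intro x
    rw [← sum_div, div_self (hpos x).ne']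
  · intro x i hi j
    have h1 : 0 < w x i := by
      by_contra hc
      have h2 : w x i = 0 := le_antisymm (not_lt.1 hc) (hw0 x i)
      simp [h2] at hi
    have h2 : 0 < U i x - mx x + δ := by
      rcases lt_max_iff.1 h1 with h | h
      · exact absurd h (lt_irrefl _)
      · exact h
    have := hle x j
    linarith

end GameAux




/-- Every anonymous game with `s` strategies and Lipschitz constant `lam` has an
`(8s² + 12s + 4)·lam`-approximate pure Nash equilibrium. -/
theorem anonymous_game_approx_pure_nash
    (n s : ℕ) (hn : 2 ≤ n) (hs : 2 ≤ s) (lam : ℝ) (hlam : 0 < lam)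
    (u : Fin n → Fin s → (Fin s → ℕ) → ℝ)
    (hrange : ∀ (p : Fin n) (i : Fin s) (x : Fin s → ℕ),
      (∑ j, x j) = n - 1 → u p i x ∈ Set.Icc (0 : ℝ) 1)
    (hlip : ∀ (p : Fin n) (i : Fin s) (x y : Fin s → ℕ),
      (∑ j, x j) = n - 1 → (∑ j, y j) = n - 1 →
      |u p i x - u p i y| ≤ lam * ∑ j, |(x j : ℝ) - (y j : ℝ)|) :
    ∃ S : Fin n → Fin s, ∀ (p : Fin n) (i : Fin s),
      u p i (fun j => (Finset.univ.filter (fun q => q ≠ p ∧ S q = j)).card) ≤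
        u p (S p) (fun j => (Finset.univ.filter (fun q => q ≠ p ∧ S q = j)).card) +
          (8 * (s : ℝ) ^ 2 + 12 * s + 4) * lam := by
  classical
  have hs0 : 0 < s := by omega
  have hext : ∀ p i, ∃ U : (Fin s → ℝ) → ℝ, Continuous U ∧
      ∀ (x : Fin s → ℝ) (y : Fin s → ℕ), ∑ j, y j = n - 1 →
      |U x - u p i y| ≤ lam * ∑ j, |x j - (y j : ℝ)| := fun p i =>
    GameAux.extend s (n - 1) hs0 lam hlam (u p i) (hlip p i)
  choose U hUc hU using hext
  have hbr := fun p => GameAux.smooth_br s hs0 lam hlam (U p) (hUc p)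
  choose ρ hρc hρ0 hρ1 hρ using hbr
  obtain ⟨x, hxsum, hx⟩ := BrouwerAux.approx_brouwer s n hs0 (fun x j => ∑ p, ρ p x j)
    (continuous_pi (fun j => continuous_finsetSum _ (fun p _ => hρc p j)))
    (fun x j => sum_nonneg (fun p _ => hρ0 p x j))
    (fun x => by rw [sum_comm]; simp [hρ1]) 1 one_pos
  obtain ⟨S, hS, hround⟩ := RoundAux.rounding (fun p j => ρ p x j) (fun p j => hρ0 p x j)
    (fun p => hρ1 p x)
  simp only [Fintype.card_fin] at hround
  have hfsum : ∑ j, ∑ p, ρ p x j = (n : ℝ) := by rw [sum_comm]; simp [hρ1]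
  have hfix : ∑ j, |x j - ∑ p, ρ p x j| ≤ 2 * (s : ℝ) := by
    have h1 : ∑ j, |x j - ∑ p, ρ p x j| ≤ ∑ j, (∑ p, ρ p x j - x j + 2) := by
      apply sum_le_sum
      intro j _
      have := hx j
      rw [abs_le]
      constructor <;> linarith
    rw [sum_add_distrib, sum_sub_distrib, hfsum, hxsum] at h1
    simp only [sum_const, card_univ, Fintype.card_fin, nsmul_eq_mul] at h1
    linarith
  refine ⟨S, ?_⟩
  intro p i
  set y : Fin s → ℕ := fun j => (Finset.univ.filter (fun q => q ≠ p ∧ S q = j)).card with hy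
  have hyc : ∀ j, (univ.filter (fun q => S q = j)).card = y j + if S p = j then 1 else 0 := by
    intro j
    have h1 : univ.filter (fun q => q ≠ p ∧ S q = j) = (univ.filter (fun q => S q = j)).erase p := by
      ext q; simp
    simp only [hy, h1]
    split_ifs with h
    · rw [card_erase_add_one]
      simp [h]
    · rw [erase_eq_of_notMem]
      · simp
      · simp [h]
  have hysum : ∑ j, y j = n - 1 := by
    have h1 : ∑ j, (univ.filter (fun q => S q = j)).card = n := by
      rw [← card_eq_sum_card_fiberwise (fun q _ => mem_univ (S q))]
      simp
    simp only [hyc, sum_add_distrib] at h1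
    simp at h1
    omega
  have hdist : ∑ j, |x j - (y j : ℝ)| ≤ 4 * (s : ℝ) + 1 := by
    have h1 : ∑ j, |x j - (y j : ℝ)| ≤ ∑ j, (|x j - ∑ p, ρ p x j| +
        |((univ.filter (fun q => S q = j)).card : ℝ) - ∑ p, ρ p x j| +
          if S p = j then (1 : ℝ) else 0) := by
      apply sum_le_sum
      intro j _
      have h2 : ((univ.filter (fun q => S q = j)).card : ℝ) =
          (y j : ℝ) + if S p = j then (1 : ℝ) else 0 := by
        rw [hyc j]; push_cast; rfl
      rw [h2]
      have h3 : (0 : ℝ) ≤ if S p = j then (1 : ℝ) else 0 := by split_ifs <;> norm_num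
      generalize (if S p = j then (1 : ℝ) else 0) = t at *
      have a1 := abs_le.1 (le_refl |x j - ∑ p, ρ p x j|)
      have a2 := abs_le.1 (le_refl |(y j : ℝ) + t - ∑ p, ρ p x j|)
      rw [abs_le]
      constructor <;> linarith [a1.1, a1.2, a2.1, a2.2]
    rw [sum_add_distrib, sum_add_distrib] at h1
    simp only [sum_ite_eq, mem_univ, if_true] at h1
    linarith
  have hb := mul_le_mul_of_nonneg_left hdist hlam.le
  have h1 := abs_le.1 ((hU p i x y hysum).trans hb)
  have h2 := abs_le.1 ((hU p (S p) x y hysum).trans hb)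
  have h3 := hρ p x (S p) (hS p) i
  have hs2 : (2 : ℝ) ≤ s := by exact_mod_cast hs
  have h4 : lam + 2 * (lam * (4 * (s : ℝ) + 1)) ≤ (8 * (s : ℝ) ^ 2 + 12 * s + 4) * lam := by
    have : 0 ≤ (8 * (s : ℝ) ^ 2 + 4 * s + 1) * lam := by positivity
    linarith
  linarith [h1.1, h1.2, h2.1, h2.2]
end

section
/- Let μ_1, μ_2 ∈ ℝ and σ_1², σ_2² > 0 be such that ⌊μ_1 − σ_1²⌋ ≤ ⌊μ_2 − σ_2²⌋. Then ||TP(μ_1, σ_1²) − TP(μ_2, σ_2²)|| ≤ |μ_1 − μ_2|/σ_1 + (|σ_1² − σ_2²| + 1)/σ_1². -/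
/-- The Poisson distribution with parameter `lam`. -/
noncomputable def poissonPMF (lam : ℝ) (i : ℕ) : ℝ :=
  Real.exp (-lam) * lam ^ i / (Nat.factorial i)

/-- The translated Poisson distribution `TP(μ, σ²)`: the law of
`⌊μ − σ²⌋ + Z` where `Z ~ Poisson(σ² + {μ − σ²})`. -/
noncomputable def TP (μ σ2 : ℝ) (z : ℤ) : ℝ :=
  if ⌊μ - σ2⌋ ≤ z then poissonPMF (σ2 + Int.fract (μ - σ2)) (z - ⌊μ - σ2⌋).toNat else 0

/-- Total variation distance between two distributions on `ℤ`. -/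
noncomputable def tvDistZ (P Q : ℤ → ℝ) : ℝ := (1 / 2) * ∑' z : ℤ, |P z - Q z|

open Filter Topology Finset

lemma pp_pos {l : ℝ} (hl : 0 < l) (n : ℕ) : 0 < poissonPMF l n := by
  unfold poissonPMF; positivity

lemma pp_nonneg {l : ℝ} (hl : 0 ≤ l) (n : ℕ) : 0 ≤ poissonPMF l n := by
  unfold poissonPMF; positivity

lemma pp_succ (l : ℝ) (n : ℕ) : ((n : ℝ) + 1) * poissonPMF l (n + 1) = l * poissonPMF l n := by
  unfold poissonPMF
  rw [Nat.factorial_succ]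
  push_cast
  have : (n.factorial : ℝ) ≠ 0 := by positivity
  have h2 : (n : ℝ) + 1 ≠ 0 := by positivity
  field_simp
  ring

lemma pp_hasSum (l : ℝ) : HasSum (poissonPMF l) 1 := by
  have h := (NormedSpace.expSeries_div_hasSum_exp (𝔸 := ℝ) l).mul_left (Real.exp (-l))
  rw [← Real.exp_eq_exp_ℝ, ← Real.exp_add, neg_add_cancel, Real.exp_zero] at h
  have e : poissonPMF l = fun n => Real.exp (-l) * (l ^ n / (n.factorial : ℝ)) := by
    funext n
    unfold poissonPMF
    ring
  rw [e]
  exact h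

lemma pp_hasDerivAt_zero (x : ℝ) :
    HasDerivAt (fun y => poissonPMF y 0) (-poissonPMF x 0) x := by
  simp only [poissonPMF, pow_zero, Nat.factorial_zero, Nat.cast_one, div_one, mul_one]
  simpa using (hasDerivAt_neg x).exp

lemma pp_hasDerivAt_succ (x : ℝ) (n : ℕ) :
    HasDerivAt (fun y => poissonPMF y (n + 1)) (poissonPMF x n - poissonPMF x (n + 1)) x := by
  have h := (((hasDerivAt_neg x).exp).mul (hasDerivAt_pow (n + 1) x)).div_const
    ((n + 1).factorial : ℝ)
  refine h.congr_deriv ?_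
  unfold poissonPMF
  rw [Nat.factorial_succ]
  push_cast
  have : (n.factorial : ℝ) ≠ 0 := by positivity
  have h2 : (n : ℝ) + 1 ≠ 0 := by positivity
  field_simp
  try simp only [Nat.add_sub_cancel]
  ring

lemma FF_hasDerivAt (x : ℝ) (k : ℕ) :
    HasDerivAt (fun y => ∑ i ∈ range (k + 1), poissonPMF y i) (-poissonPMF x k) x := by
  induction k with
  | zero => simpa using pp_hasDerivAt_zero x
  | succ k ih =>
    have h := ih.add (pp_hasDerivAt_succ x k)
    have e : (fun y => ∑ i ∈ range (k + 1 + 1), poissonPMF y i)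
      = (fun y => ∑ i ∈ range (k + 1), poissonPMF y i) + (fun y => poissonPMF y (k + 1)) := by
      ext y; simp [Finset.sum_range_succ]
    rw [e]
    exact h.congr_deriv (by ring)

lemma pp_le_stirling {x : ℝ} (hx : 0 < x) {n : ℕ} (hn : 0 < n) :
    poissonPMF x n * √(2 * Real.pi * n) ≤ 1 := by
  have hn' : (0 : ℝ) < n := by exact_mod_cast hn
  have h1 : (x / n) ^ n ≤ Real.exp (x - n) := by
    have : x / n ≤ Real.exp (x / n - 1) := by
      have := Real.add_one_le_exp (x / n - 1); linarith
    calc (x / n) ^ n ≤ (Real.exp (x / n - 1)) ^ n := by gcongr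
      _ = Real.exp (x - n) := by
        rw [← Real.exp_nat_mul]; congr 1; field_simp
  have h2 : Real.exp (-x) * x ^ n ≤ (n / Real.exp 1) ^ n := by
    rw [div_pow, div_le_iff₀ (by positivity), Real.exp_sub, div_mul_eq_mul_div,
      le_div_iff₀ (by positivity)] at h1
    rw [div_pow, le_div_iff₀ (by positivity), ← Real.exp_nat_mul, mul_one, Real.exp_neg]
    have := Real.exp_pos x
    have e : (Real.exp x)⁻¹ * x ^ n * Real.exp n = (x ^ n * Real.exp n) / Real.exp x := by
      field_simp
    rw [e, div_le_iff₀ this]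
    linarith
  have h3 := Stirling.le_factorial_stirling n
  unfold poissonPMF
  rw [div_mul_eq_mul_div, div_le_one (by positivity)]
  calc _ ≤ (n / Real.exp 1) ^ n * √(2 * Real.pi * n) := by gcongr
    _ ≤ _ := by linarith

lemma key_ineq {x : ℝ} (hx : 0 < x) {k : ℕ} (hk : 1 ≤ k) :
    4 * (x * √x) * poissonPMF x k ≤ x + k + 1 / 2 := by
  have hk' : (1 : ℝ) ≤ k := by exact_mod_cast hk
  have h1 := pp_le_stirling hx (n := k + 1) (by omega)
  have h2 := pp_succ x k
  push_cast at h1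
  have hp := pp_pos hx (k + 1)
  have h3 : 2 * ((k : ℝ) + 1) ≤ √(2 * Real.pi * (k + 1)) * √(k + 1 / 2) := by
    rw [← Real.sqrt_mul (by positivity)]
    apply Real.le_sqrt_of_sq_le
    have : 2 * ((k : ℝ) + 1) ≤ Real.pi * (k + 1 / 2) := by nlinarith [Real.pi_gt_three]
    nlinarith
  have h4 : 2 * (x * poissonPMF x k) ≤ √(k + 1 / 2) := by
    rw [← h2]
    calc _ = poissonPMF x (k + 1) * (2 * ((k : ℝ) + 1)) := by ring
      _ ≤ poissonPMF x (k + 1) * (√(2 * Real.pi * (k + 1)) * √(k + 1 / 2)) := by gcongr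
      _ = (poissonPMF x (k + 1) * √(2 * Real.pi * (k + 1))) * √(k + 1 / 2) := by ring
      _ ≤ 1 * √(k + 1 / 2) := by gcongr
      _ = _ := one_mul _
  have s1 := Real.sq_sqrt hx.le
  have s2 := Real.sq_sqrt (show (0 : ℝ) ≤ k + 1 / 2 by positivity)
  have s3 := Real.sqrt_nonneg x
  nlinarith [sq_nonneg (√x - √((k : ℝ) + 1 / 2)), mul_le_mul_of_nonneg_left h4 s3]

lemma tendsto_pp (k : ℕ) : Tendsto (fun x => poissonPMF x k) atTop (𝓝 0) := by
  have h := (Real.tendsto_pow_mul_exp_neg_atTop_nhds_zero k).div_const (k.factorial : ℝ)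
  rw [zero_div] at h
  refine h.congr fun x => ?_
  unfold poissonPMF; ring

lemma tendsto_sqrt_pp (k : ℕ) : Tendsto (fun x => √x * poissonPMF x k) atTop (𝓝 0) := by
  have h := (tendsto_pp (k + 1)).const_mul ((k : ℝ) + 1)
  rw [mul_zero] at h
  refine tendsto_of_tendsto_of_tendsto_of_le_of_le' tendsto_const_nhds h ?_ ?_
  · filter_upwards [eventually_ge_atTop 1] with x hx
    exact mul_nonneg (Real.sqrt_nonneg _) (pp_nonneg (by linarith) _)
  · filter_upwards [eventually_ge_atTop 1] with x hx
    rw [pp_succ]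
    gcongr
    · exact pp_nonneg (by linarith) _
    · exact Real.sqrt_le_iff.2 ⟨by linarith, by nlinarith⟩

/-- The central estimate `F (1 - F) ≤ √λ p_k(λ)`. -/
lemma FG_le {x : ℝ} (hx : 0 < x) (k : ℕ) :
    (∑ i ∈ range (k + 1), poissonPMF x i) * (1 - ∑ i ∈ range (k + 1), poissonPMF x i)
      ≤ √x * poissonPMF x k := by
  rcases Nat.eq_zero_or_pos k with rfl | hk
  · simp only [zero_add, range_one, sum_singleton]
    rw [mul_comm]
    refine mul_le_mul_of_nonneg_right ?_ (pp_nonneg hx.le _)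
    simp only [poissonPMF, pow_zero, Nat.factorial_zero, Nat.cast_one, div_one, mul_one]
    rcases le_total x 1 with h | h
    · have h1 := Real.add_one_le_exp (-x)
      have : x ≤ √x := Real.le_sqrt_of_sq_le (by nlinarith)
      linarith
    · have h1 := Real.exp_pos (-x)
      have : 1 ≤ √x := Real.one_le_sqrt.mpr h
      linarith
  set F : ℝ → ℝ := fun y => ∑ i ∈ range (k + 1), poissonPMF y i with hF
  set H : ℝ → ℝ := fun y => √y * poissonPMF y k - F y * (1 - F y) with hH
  set B : ℝ → ℝ := fun y => (k + 1 / 2) / √y - √y - (2 * F y - 1) with hB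
  have dF : ∀ y, HasDerivAt F (-poissonPMF y k) y := fun y => FF_hasDerivAt y k
  have dp : ∀ y, 0 < y → HasDerivAt (fun y => poissonPMF y k)
      (poissonPMF y k * (k / y - 1)) y := by
    intro y hy
    obtain ⟨j, rfl⟩ : ∃ j, k = j + 1 := ⟨k - 1, by omega⟩
    refine (pp_hasDerivAt_succ y j).congr_deriv ?_
    have := pp_succ y j
    push_cast
    field_simp
    linarith
  have dH : ∀ y, 0 < y → HasDerivAt H (poissonPMF y k * B y) y := by
    intro y hy
    have hs : 0 < √y := Real.sqrt_pos.mpr hy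
    have h := ((Real.hasDerivAt_sqrt hy.ne').mul (dp y hy)).sub
      ((dF y).mul ((dF y).const_sub 1))
    refine h.congr_deriv ?_
    have hy2 : √y * (k / y - 1) = k / √y - √y := by
      have := Real.sq_sqrt hy.le
      field_simp
      rw [this]
    simp only [hB]
    linear_combination poissonPMF y k * hy2
  have dB : ∀ y, 0 < y → HasDerivAt B
      ((k + 1 / 2) * (-(1 / (2 * √y)) / (√y) ^ 2) - 1 / (2 * √y) - 2 * (-poissonPMF y k)) y := by
    intro y hy
    have hs : 0 < √y := Real.sqrt_pos.mpr hy
    have h := ((((Real.hasDerivAt_sqrt hy.ne').inv hs.ne').const_mul ((k : ℝ) + 1 / 2)).sub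
      (Real.hasDerivAt_sqrt hy.ne')).sub (((dF y).const_mul 2).sub_const 1)
    exact h
  have aB : AntitoneOn B (Set.Ioi 0) := by
    refine antitoneOn_of_deriv_nonpos (convex_Ioi 0)
      (fun y hy => (dB y hy).continuousAt.continuousWithinAt) ?_ ?_
    · rw [interior_Ioi]
      exact fun y hy => (dB y hy).differentiableAt.differentiableWithinAt
    · rw [interior_Ioi]
      intro y hy
      have hy : 0 < y := hy
      rw [(dB y hy).deriv]
      have hs : 0 < √y := Real.sqrt_pos.mpr hy
      have h := key_ineq hy hk
      have h2 := Real.sq_sqrt hy.le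
      have : (k + 1 / 2) * (-(1 / (2 * √y)) / (√y) ^ 2) - 1 / (2 * √y) - 2 * (-poissonPMF y k)
        = (4 * (y * √y) * poissonPMF y k - (y + k + 1 / 2)) / (2 * (y * √y)) := by
        rw [h2]
        field_simp
        ring
      rw [this]
      exact div_nonpos_of_nonpos_of_nonneg (by linarith) (by positivity)
  have cp : Continuous (fun y => poissonPMF y k) := by
    unfold poissonPMF; fun_prop
  have cF : Continuous F := by
    rw [hF]; unfold poissonPMF; fun_prop
  have cH : Continuous H := by
    rw [hH]; fun_prop
  suffices 0 ≤ H x by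
    simp only [hH] at this
    linarith
  rcases le_or_gt 0 (B x) with hb | hb
  · have hm : MonotoneOn H (Set.Icc 0 x) := by
      refine monotoneOn_of_deriv_nonneg (convex_Icc 0 x) cH.continuousOn ?_ ?_
      · rw [interior_Icc]
        exact fun y hy => (dH y hy.1).differentiableAt.differentiableWithinAt
      · rw [interior_Icc]
        intro y hy
        rw [(dH y hy.1).deriv]
        exact mul_nonneg (pp_nonneg hy.1.le _) (hb.trans (aB hy.1 hx hy.2.le))
    have h0 : H 0 = 0 := by
      have : F 0 = 1 := by
        simp [hF, poissonPMF, Finset.sum_range_succ']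
      simp [hH, this]
    rw [← h0]
    exact hm ⟨le_rfl, hx.le⟩ ⟨hx.le, le_rfl⟩ hx.le
  · have hm : AntitoneOn H (Set.Ici x) := by
      refine antitoneOn_of_deriv_nonpos (convex_Ici x) cH.continuousOn ?_ ?_
      · rw [interior_Ici]
        exact fun y hy => (dH y (hx.trans hy)).differentiableAt.differentiableWithinAt
      · rw [interior_Ici]
        intro y hy
        have hy0 : 0 < y := hx.trans hy
        rw [(dH y hy0).deriv]
        exact mul_nonpos_of_nonneg_of_nonpos (pp_nonneg hy0.le _)
          ((aB hx hy0 (le_of_lt hy)).trans hb.le)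
    have tF : Tendsto F atTop (𝓝 0) := by
      have := tendsto_finsetSum (range (k + 1)) (fun i _ => tendsto_pp i)
      simpa [hF] using this
    have tH : Tendsto H atTop (𝓝 0) := by
      have := (tendsto_sqrt_pp k).sub (tF.mul (tF.const_sub 1))
      simpa [hH] using this
    refine le_of_tendsto tH ?_
    filter_upwards [eventually_ge_atTop x] with y hy
    exact hm Set.self_mem_Ici hy hy

section Stein
variable (l : ℝ) (h : ℕ → ℝ)

/-- Mean of `h` under Poisson. -/
noncomputable def pMean : ℝ := ∑' i, h i * poissonPMF l i
/-- Partial sums. -/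
noncomputable def pPart (k : ℕ) : ℝ := ∑ i ∈ range k, h i * poissonPMF l i
/-- Partial sums of the mass function. -/
noncomputable def pCdf (k : ℕ) : ℝ := ∑ i ∈ range k, poissonPMF l i
/-- Solution of the Stein equation. -/
noncomputable def stein (k : ℕ) : ℝ :=
  (pPart l h k - pMean l h * pCdf l k) / (k * poissonPMF l k)
end Stein

lemma h_summable {l : ℝ} (hl : 0 < l) {h : ℕ → ℝ} (h0 : ∀ n, 0 ≤ h n) (h1 : ∀ n, h n ≤ 1) :
    Summable (fun i => h i * poissonPMF l i) :=
  Summable.of_nonneg_of_le (fun n => mul_nonneg (h0 n) (pp_nonneg hl.le n))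
    (fun n => mul_le_of_le_one_left (pp_nonneg hl.le n) (h1 n)) (pp_hasSum l).summable

lemma pPart_nonneg {l : ℝ} (hl : 0 < l) {h : ℕ → ℝ} (h0 : ∀ n, 0 ≤ h n) (k : ℕ) :
    0 ≤ pPart l h k :=
  Finset.sum_nonneg fun n _ => mul_nonneg (h0 n) (pp_nonneg hl.le n)

lemma pPart_le {l : ℝ} (hl : 0 < l) {h : ℕ → ℝ} (h1 : ∀ n, h n ≤ 1) (k : ℕ) :
    pPart l h k ≤ pCdf l k :=
  Finset.sum_le_sum fun n _ => mul_le_of_le_one_left (pp_nonneg hl.le n) (h1 n)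

lemma tail_eq {l : ℝ} (k : ℕ) : 1 - pCdf l k = ∑' i, poissonPMF l (i + k) := by
  have := (pp_hasSum l).summable.sum_add_tsum_nat_add k
  rw [(pp_hasSum l).tsum_eq] at this
  unfold pCdf; linarith

lemma htail_eq {l : ℝ} (hl : 0 < l) {h : ℕ → ℝ} (h0 : ∀ n, 0 ≤ h n) (h1 : ∀ n, h n ≤ 1) (k : ℕ) :
    pMean l h - pPart l h k = ∑' i, h (i + k) * poissonPMF l (i + k) := by
  have := (h_summable hl h0 h1).sum_add_tsum_nat_add k
  unfold pMean pPart; linarith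

lemma htail_nonneg {l : ℝ} (hl : 0 < l) {h : ℕ → ℝ} (h0 : ∀ n, 0 ≤ h n) (h1 : ∀ n, h n ≤ 1)
    (k : ℕ) : 0 ≤ pMean l h - pPart l h k := by
  rw [htail_eq hl h0 h1]
  exact tsum_nonneg fun n => mul_nonneg (h0 _) (pp_nonneg hl.le _)

lemma htail_le {l : ℝ} (hl : 0 < l) {h : ℕ → ℝ} (h0 : ∀ n, 0 ≤ h n) (h1 : ∀ n, h n ≤ 1)
    (k : ℕ) : pMean l h - pPart l h k ≤ 1 - pCdf l k := by
  rw [htail_eq hl h0 h1, tail_eq]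
  exact Summable.tsum_le_tsum (fun n => mul_le_of_le_one_left (pp_nonneg hl.le _) (h1 _))
    ((summable_nat_add_iff k).2 (h_summable hl h0 h1))
    ((summable_nat_add_iff k).2 (pp_hasSum l).summable)

lemma cdf_ineq {l : ℝ} (hl : 0 < l) (k : ℕ) : l * pCdf l k ≤ k * pCdf l (k + 1) := by
  unfold pCdf
  rw [Finset.sum_range_succ', Finset.mul_sum, mul_add, Finset.mul_sum]
  have : ∑ i ∈ range k, l * poissonPMF l i ≤ ∑ i ∈ range k, k * poissonPMF l (i + 1) := by
    refine Finset.sum_le_sum fun i hi => ?_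
    rw [← pp_succ]
    have : (i : ℝ) + 1 ≤ k := by exact_mod_cast Finset.mem_range.1 hi
    exact mul_le_mul_of_nonneg_right this (pp_nonneg hl.le _)
  have := mul_nonneg (Nat.cast_nonneg (α := ℝ) k) (pp_nonneg hl.le 0)
  linarith

lemma tail_ineq {l : ℝ} (hl : 0 < l) (k : ℕ) :
    k * (1 - pCdf l (k + 1)) ≤ l * (1 - pCdf l k) := by
  rw [tail_eq, tail_eq, ← tsum_mul_left, ← tsum_mul_left]
  refine Summable.tsum_le_tsum (fun i => ?_)
    (((summable_nat_add_iff (k + 1)).2 (pp_hasSum l).summable).mul_left _)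
    (((summable_nat_add_iff k).2 (pp_hasSum l).summable).mul_left _)
  rw [← pp_succ, ← add_assoc]
  refine mul_le_mul_of_nonneg_right ?_ (pp_nonneg hl.le _)
  push_cast
  have : (0 : ℝ) ≤ i := Nat.cast_nonneg i
  linarith

lemma stein_succ {l : ℝ} (h : ℕ → ℝ) (k : ℕ) :
    stein l h (k + 1) = (pPart l h (k + 1) - pMean l h * pCdf l (k + 1)) / (l * poissonPMF l k) := by
  unfold stein
  push_cast
  rw [pp_succ]

lemma stein_eq {l : ℝ} (hl : 0 < l) (h : ℕ → ℝ) (n : ℕ) :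
    l * stein l h (n + 1) - n * stein l h n = h n - pMean l h := by
  have hp := pp_pos hl n
  rw [stein_succ]
  have e1 : pPart l h (n + 1) = pPart l h n + h n * poissonPMF l n := Finset.sum_range_succ _ _
  have e2 : pCdf l (n + 1) = pCdf l n + poissonPMF l n := Finset.sum_range_succ _ _
  rw [e1, e2]
  unfold stein
  rcases Nat.eq_zero_or_pos n with rfl | hn
  · simp only [pPart, pCdf, range_zero, sum_empty]
    field_simp
    simp
    try ring
  · have : (0 : ℝ) < n := by exact_mod_cast hn
    field_simp
    ring

lemma stein_bound {l : ℝ} (hl : 0 < l) {h : ℕ → ℝ} (h0 : ∀ n, 0 ≤ h n) (h1 : ∀ n, h n ≤ 1)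
    (n : ℕ) : |stein l h n| ≤ 1 / √l := by
  rcases n with _ | k
  · simp [stein]
  have hp := pp_pos hl k
  have hs : 0 < √l := Real.sqrt_pos.mpr hl
  rw [stein_succ, abs_div, abs_of_pos (mul_pos hl hp), div_le_div_iff₀ (by positivity) hs, one_mul]
  have a1 := pPart_nonneg hl h0 (k + 1)
  have a2 := pPart_le hl h1 (k + 1)
  have b1 := htail_nonneg hl h0 h1 (k + 1)
  have b2 := htail_le hl h0 h1 (k + 1)
  have hFG : pCdf l (k + 1) * (1 - pCdf l (k + 1)) ≤ √l * poissonPMF l k := FG_le hl k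
  have hF : 0 ≤ pCdf l (k + 1) := a1.trans a2
  have hG : 0 ≤ 1 - pCdf l (k + 1) := b1.trans b2
  have : |pPart l h (k + 1) - pMean l h * pCdf l (k + 1)| ≤ √l * poissonPMF l k := by
    refine le_trans ?_ hFG
    rw [abs_le]
    constructor
    · nlinarith [mul_nonneg a1 hG, mul_le_mul_of_nonneg_right b2 hF]
    · nlinarith [mul_nonneg b1 hF, mul_le_mul_of_nonneg_right a2 hG]
  calc _ ≤ √l * poissonPMF l k * √l := by gcongr
    _ = (√l) ^ 2 * poissonPMF l k := by ring
    _ = _ := by rw [Real.sq_sqrt hl.le]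

lemma stein_diff_bound {l : ℝ} (hl : 0 < l) {h : ℕ → ℝ} (h0 : ∀ n, 0 ≤ h n) (h1 : ∀ n, h n ≤ 1)
    (k : ℕ) : |stein l h (k + 1) - stein l h k| ≤ 1 / l := by
  have hp := pp_pos hl k
  rcases Nat.eq_zero_or_pos k with rfl | hk
  · have e := stein_eq hl h 0
    have z : stein l h 0 = 0 := by simp [stein]
    have b1 := htail_nonneg hl h0 h1 0
    have b2 := htail_le hl h0 h1 0
    simp only [pPart, pCdf, range_zero, sum_empty, sub_zero] at b1 b2
    rw [z, mul_zero, sub_zero] at e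
    rw [z, sub_zero, le_div_iff₀ hl, ← abs_of_pos hl, ← abs_mul, abs_of_pos hl, mul_comm, e, abs_le]
    constructor <;> linarith [h0 0, h1 0]
  have hk' : (0 : ℝ) < k := by exact_mod_cast hk
  have e1 : pPart l h (k + 1) = pPart l h k + h k * poissonPMF l k := Finset.sum_range_succ _ _
  have e2 : pCdf l (k + 1) = pCdf l k + poissonPMF l k := Finset.sum_range_succ _ _
  have a1 := pPart_nonneg hl h0 k
  have a2 := pPart_le hl h1 k
  have b1 := htail_nonneg hl h0 h1 (k + 1)
  have b2 := htail_le hl h0 h1 (k + 1)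
  have c1 : 0 ≤ h k * poissonPMF l k := mul_nonneg (h0 k) hp.le
  have c2 : h k * poissonPMF l k ≤ poissonPMF l k := mul_le_of_le_one_left hp.le (h1 k)
  have i1 := cdf_ineq hl k
  have i2 := tail_ineq hl k
  rw [stein_succ]
  unfold stein
  rw [e1] at *
  rw [e2] at *
  generalize h k * poissonPMF l k = c at *
  generalize poissonPMF l k = p at *
  generalize pPart l h k = a at *
  generalize pCdf l k = f at *
  generalize (k : ℝ) = K at *
  obtain ⟨b, hb⟩ : ∃ b, b = pMean l h - (a + c) := ⟨_, rfl⟩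
  have hm : pMean l h = a + b + c := by linarith
  rw [← hb] at b1 b2
  rw [hm]
  obtain ⟨G, hG⟩ : ∃ G, G = 1 - (f + p) := ⟨_, rfl⟩
  rw [← hG] at b2 i2
  have hG0 : 0 ≤ G := b1.trans b2
  have hf0 : 0 ≤ f := a1.trans a2
  have hp1 : p = 1 - f - G := by linarith
  have eN : (a + c - (a + b + c) * (f + p)) / (l * p) - (a - (a + b + c) * f) / (K * p)
      = (a * (K * G - l * (1 - f)) + b * (l * f - K * (f + p)) + c * (K * G + l * f))
        / (l * (K * p)) := by
    rw [hG]
    field_simp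
    ring
  have hKp : 0 < K * p := by positivity
  rw [eN, abs_div, abs_of_pos (show 0 < l * (K * p) by positivity),
    div_le_div_iff₀ (by positivity) hl, one_mul, mul_comm l (K * p)]
  refine mul_le_mul_of_nonneg_right ?_ hl.le
  have t1 : 0 ≤ a * (l * (1 - f) - K * G) := mul_nonneg a1 (by linarith)
  have t2 : 0 ≤ b * (K * (f + p) - l * f) := mul_nonneg b1 (by linarith)
  have t0 : 0 ≤ K * G + l * f := by positivity
  have t3 : 0 ≤ c * (K * G + l * f) := mul_nonneg c1 t0
  have u1 : a * (l * (1 - f) - K * G) ≤ f * (l * (1 - f) - K * G) :=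
    mul_le_mul_of_nonneg_right a2 (by linarith)
  have u2 : b * (K * (f + p) - l * f) ≤ G * (K * (f + p) - l * f) :=
    mul_le_mul_of_nonneg_right b2 (by linarith)
  have u3 : c * (K * G + l * f) ≤ p * (K * G + l * f) := mul_le_mul_of_nonneg_right c2 t0
  have w : K * G + l * f ≤ K := by
    have : K * (f + p) + K * G = K := by rw [hp1]; ring
    linarith
  have w2 : p * (K * G + l * f) ≤ K * p := by
    have := mul_le_mul_of_nonneg_left w hp.le
    linarith
  have w3 : f * (l * (1 - f) - K * G) + G * (K * (f + p) - l * f) = p * (K * G + l * f) := by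
    rw [hp1]; ring
  rw [abs_le]
  constructor
  · linarith
  · linarith

/-- Main Stein estimate on `ℕ`. -/
lemma stein_main {l l2 : ℝ} (hl : 0 < l) (hl2 : 0 < l2) {h : ℕ → ℝ} (h0 : ∀ n, 0 ≤ h n)
    (h1 : ∀ n, h n ≤ 1) (d : ℕ) :
    ∑' m, h (d + m) * poissonPMF l2 m - pMean l h ≤ |l - l2 - d| / √l + |l - l2| / l := by
  set g := stein l h with hg
  have sq := (pp_hasSum l2).summable
  have sb : ∀ {f : ℕ → ℝ} (C : ℝ), (∀ n, |f n| ≤ C) → Summable (fun m => f m * poissonPMF l2 m) := by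
    intro f C hf
    refine Summable.of_norm_bounded (sq.mul_left C) fun m => ?_
    rw [Real.norm_eq_abs, abs_mul, abs_of_nonneg (pp_nonneg hl2.le m)]
    exact mul_le_mul_of_nonneg_right (hf m) (pp_nonneg hl2.le m)
  have bb : ∀ {f : ℕ → ℝ} (C : ℝ), (∀ n, |f n| ≤ C) → |∑' m, f m * poissonPMF l2 m| ≤ C := by
    intro f C hf
    have hs : HasSum (fun m => C * poissonPMF l2 m) C := by
      simpa using (pp_hasSum l2).mul_left C
    have := tsum_of_norm_bounded (f := fun m => f m * poissonPMF l2 m) hs (fun m => by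
      rw [Real.norm_eq_abs, abs_mul, abs_of_nonneg (pp_nonneg hl2.le m)]
      exact mul_le_mul_of_nonneg_right (hf m) (pp_nonneg hl2.le m))
    simpa using this
  have bg : ∀ n, |g n| ≤ 1 / √l := stein_bound hl h0 h1
  have bd : ∀ n, |g (n + 1) - g n| ≤ 1 / l := stein_diff_bound hl h0 h1
  have s1 := sb (f := fun m => g (d + m)) _ (fun n => bg _)
  have s2 := sb (f := fun m => g (d + m + 1)) _ (fun n => bg _)
  have s3 := sb (f := fun m => h (d + m)) 1 (fun n => by rw [abs_of_nonneg (h0 _)]; exact h1 _)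
  -- size-bias identity
  have k1 : HasSum (fun m : ℕ => m * (g (d + m) * poissonPMF l2 m))
      (l2 * ∑' m, g (d + m + 1) * poissonPMF l2 m) := by
    rw [← hasSum_nat_add_iff' 1]
    simp only [range_one, sum_singleton, Nat.cast_zero, zero_mul, sub_zero]
    refine (s2.hasSum.mul_left l2).congr_fun ?_
    intro m
    have e := pp_succ l2 m
    rw [← add_assoc]
    push_cast
    linear_combination g (d + m + 1) * e
  have key : HasSum (fun m => h (d + m) * poissonPMF l2 m)
      (l * (∑' m, g (d + m + 1) * poissonPMF l2 m) - (d * (∑' m, g (d + m) * poissonPMF l2 m)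
        + (l2 * ∑' m, g (d + m + 1) * poissonPMF l2 m)) + pMean l h * 1) := by
    refine (((s2.hasSum.mul_left l).sub ((s1.hasSum.mul_left (d : ℝ)).add k1)).add
      ((pp_hasSum l2).mul_left (pMean l h))).congr_fun ?_
    intro m
    have e := stein_eq hl h (d + m)
    rw [← hg] at e
    push_cast at e
    linear_combination -poissonPMF l2 m * e
  have hdiff : (∑' m, (g (d + m + 1) - g (d + m)) * poissonPMF l2 m)
      = (∑' m, g (d + m + 1) * poissonPMF l2 m) - ∑' m, g (d + m) * poissonPMF l2 m := by
    rw [← s2.tsum_sub s1]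
    exact tsum_congr fun m => by ring
  have c1 := bb (f := fun m => g (d + m)) _ (fun n => bg _)
  have c2 := bb (f := fun m => g (d + m + 1) - g (d + m)) _ (fun n => bd _)
  rw [key.tsum_eq]
  rw [hdiff] at c2
  generalize (∑' m, g (d + m + 1) * poissonPMF l2 m) = X at *
  generalize (∑' m, g (d + m) * poissonPMF l2 m) = Y at *
  have e : l * X - (d * Y + l2 * X) + pMean l h * 1 - pMean l h
    = (l - l2 - d) * Y + (l - l2) * (X - Y) := by ring
  rw [e]
  refine add_le_add ?_ ?_
  · refine (le_abs_self _).trans ?_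
    rw [abs_mul, div_eq_mul_one_div]
    gcongr
  · refine (le_abs_self _).trans ?_
    rw [abs_mul, div_eq_mul_one_div]
    gcongr

lemma TP_hasSum (μ s : ℝ) (w : ℤ → ℝ) (S : ℝ)
    (hs : HasSum (fun n : ℕ => w (⌊μ - s⌋ + n) * poissonPMF (s + Int.fract (μ - s)) n) S) :
    HasSum (fun z => w z * TP μ s z) S := by
  have hi : Function.Injective (fun n : ℕ => ⌊μ - s⌋ + (n : ℤ)) := by
    intro a b hab
    simpa using hab
  refine (hi.hasSum_iff ?_).1 ?_
  · intro z hz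
    have : ¬ ⌊μ - s⌋ ≤ z := by
      intro hle
      exact hz ⟨(z - ⌊μ - s⌋).toNat, by
        show ⌊μ - s⌋ + ((z - ⌊μ - s⌋).toNat : ℤ) = z
        omega⟩
    simp [TP, this]
  · refine hs.congr_fun fun n => ?_
    simp [TP]

/-- Total variation distance between two translated Poisson distributions
(Barbour–Lindvall): if `⌊μ₁ − σ₁²⌋ ≤ ⌊μ₂ − σ₂²⌋` then
`||TP(μ₁,σ₁²) − TP(μ₂,σ₂²)|| ≤ |μ₁−μ₂|/σ₁ + (|σ₁²−σ₂²|+1)/σ₁²`. -/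
theorem translated_poisson_tv_bound
    (μ1 μ2 σsq1 σsq2 : ℝ) (h1 : 0 < σsq1) (h2 : 0 < σsq2)
    (hfloor : ⌊μ1 - σsq1⌋ ≤ ⌊μ2 - σsq2⌋) :
    tvDistZ (TP μ1 σsq1) (TP μ2 σsq2) ≤
      |μ1 - μ2| / Real.sqrt σsq1 + (|σsq1 - σsq2| + 1) / σsq1 := by
  obtain ⟨d, hd⟩ := Int.eq_ofNat_of_zero_le (sub_nonneg.2 hfloor)
  have f1 := Int.fract_nonneg (μ1 - σsq1)
  have f1' := Int.fract_lt_one (μ1 - σsq1)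
  have f2 := Int.fract_nonneg (μ2 - σsq2)
  have f2' := Int.fract_lt_one (μ2 - σsq2)
  have g1 := Int.floor_add_fract (μ1 - σsq1)
  have g2 := Int.floor_add_fract (μ2 - σsq2)
  have hd' : (⌊μ2 - σsq2⌋ : ℝ) - ⌊μ1 - σsq1⌋ = d := by exact_mod_cast hd
  set l1 := σsq1 + Int.fract (μ1 - σsq1) with hl1
  set l2 := σsq2 + Int.fract (μ2 - σsq2) with hl2
  have p1 : 0 < l1 := by linarith
  have p2 : 0 < l2 := by linarith
  classical
  let w : ℤ → ℝ := fun z => if TP μ1 σsq1 z < TP μ2 σsq2 z then 1 else 0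
  have w0 : ∀ z, 0 ≤ w z := fun z => by simp only [w]; split_ifs <;> norm_num
  have w1 : ∀ z, w z ≤ 1 := fun z => by simp only [w]; split_ifs <;> norm_num
  have S1 : HasSum (fun z => (1 : ℝ) * TP μ1 σsq1 z) 1 :=
    TP_hasSum μ1 σsq1 (fun _ => 1) 1 (by simpa using pp_hasSum l1)
  have S2 : HasSum (fun z => (1 : ℝ) * TP μ2 σsq2 z) 1 :=
    TP_hasSum μ2 σsq2 (fun _ => 1) 1 (by simpa using pp_hasSum l2)
  let h : ℕ → ℝ := fun n => w (⌊μ1 - σsq1⌋ + n)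
  have h0 : ∀ n, 0 ≤ h n := fun n => w0 _
  have hh1 : ∀ n, h n ≤ 1 := fun n => w1 _
  have T1 : HasSum (fun z => w z * TP μ1 σsq1 z) (pMean l1 h) :=
    TP_hasSum μ1 σsq1 w _ (h_summable p1 h0 hh1).hasSum
  have T2 : HasSum (fun z => w z * TP μ2 σsq2 z) (∑' m, h (d + m) * poissonPMF l2 m) := by
    refine TP_hasSum μ2 σsq2 w _ ?_
    have hs := (h_summable (h := fun m => h (d + m)) p2 (fun _ => h0 _) (fun _ => hh1 _)).hasSum
    refine hs.congr_fun fun n => ?_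
    have : ⌊μ1 - σsq1⌋ + ((d + n : ℕ) : ℤ) = ⌊μ2 - σsq2⌋ + n := by push_cast; omega
    simp only [h, this]
    rfl
  have main := stein_main p1 p2 h0 hh1 d
  have U : HasSum (fun z => |TP μ1 σsq1 z - TP μ2 σsq2 z|)
      (2 * ((∑' m, h (d + m) * poissonPMF l2 m) - pMean l1 h) - (1 - 1)) := by
    refine (((T2.sub T1).mul_left 2).sub (S2.sub S1)).congr_fun fun z => ?_
    simp only [w]
    split_ifs with hz
    · rw [abs_of_neg (by linarith)]; ring
    · rw [abs_of_nonneg (by linarith)]; ring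
  unfold tvDistZ
  rw [U.tsum_eq]
  have e : l1 - l2 - d = μ1 - μ2 := by rw [hl1, hl2]; linarith
  rw [e] at main
  have b1 : |μ1 - μ2| / √l1 ≤ |μ1 - μ2| / √σsq1 := by
    have : 0 < √σsq1 := Real.sqrt_pos.2 h1
    have : √σsq1 ≤ √l1 := Real.sqrt_le_sqrt (by linarith)
    gcongr
  have b2 : |l1 - l2| / l1 ≤ (|σsq1 - σsq2| + 1) / σsq1 := by
    have : |l1 - l2| ≤ |σsq1 - σsq2| + 1 := by
      have a := neg_abs_le (σsq1 - σsq2)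
      have b := le_abs_self (σsq1 - σsq2)
      rw [abs_le]
      constructor <;> linarith
    have : σsq1 ≤ l1 := by linarith
    gcongr
  linarith
end
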